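/- arXiv:1008.1266 — 2 statements merged into one kernel-verified Lean document; each statement's English description precedes it below -/
import Mathlib

section
/- For the random displacement model with i.i.d. displacements distributed according to μ, there is a ℙ-full set of configurations ω on which σ(h_ω) = Σ, where Σ = closure( ⋃_{ω ∈ C_per} σ(h_ω) ) and C_per = { ω ∈ Ω : ω is periodic and μ({ω_k}) > 0 for all k ∈ ℤ^d }. Here ω is called periodic if there is a vector K with positive integer components such that ω_{n+jK} = ω_n for all n, j ∈ ℤ^d (with jK = (j_i K_i)_i). -/
open scoped BigOperators ENNReal
open MeasureTheory

noncomputable section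

/-- Points of the lattice `ℤ^d`. -/
abbrev Zd (d : ℕ) := Fin d → ℤ

/-- 1-norm distance on `ℤ^d`. -/
def dist1 {d : ℕ} (x y : Zd d) : ℤ := ∑ i, |x i - y i|

/-- The set of nearest neighbors of a point of `ℤ^d`. -/
def nbhd {d : ℕ} (n : Zd d) : Finset (Zd d) :=
  (Fintype.piFinset fun i => Finset.Icc (n i - 1) (n i + 1)).filter fun m => dist1 n m = 1

/-- A discrete box `∏ [lo i, hi i]`. -/
def dbox {d : ℕ} (lo hi : Zd d) : Finset (Zd d) :=
  Fintype.piFinset fun i => Finset.Icc (lo i) (hi i)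

/-- `ℓ²(ℤ^d)` with real coefficients. -/
abbrev l2 (d : ℕ) := lp (fun _ : Zd d => ℝ) 2

/-- The displacement potential `V_ω(n) = ∑_k q(n - kM - ω_k)`. -/
def Vpot {d : ℕ} (M : Zd d) (q : Zd d → ℝ) (ω : Zd d → Zd d) (n : Zd d) : ℝ :=
  ∑' k : Zd d, q (fun i => n i - k i * M i - ω k i)

/-- A displacement configuration is admissible if each `ω_k ∈ Δ = ∏ [0, M i - b i]`. -/
def adm {d : ℕ} (M b : Zd d) (ω : Zd d → Zd d) : Prop :=
  ∀ k i, 0 ≤ ω k i ∧ ω k i ≤ M i - b i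

/-- A configuration `ω` is periodic if for some vector `K` of positive integers,
`ω_{n + jK} = ω_n` for all `n, j ∈ ℤ^d`. -/
def IsPerConf {d : ℕ} (ω : Zd d → Zd d) : Prop :=
  ∃ K : Fin d → ℤ, (∀ i, 0 < K i) ∧ ∀ n j : Zd d, ω (fun i => n i + j i * K i) = ω n

section Hilbert

variable {E : Type*} [NormedAddCommGroup E] [InnerProductSpace ℝ E]

lemma exists_bounded_below_of_isUnit {A : E →L[ℝ] E} (hA : IsUnit A) :
    ∃ c : ℝ, 0 < c ∧ ∀ x, c * ‖x‖ ≤ ‖A x‖ := by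
  obtain ⟨a, rfl⟩ := hA
  refine ⟨(‖((a⁻¹ : (E →L[ℝ] E)ˣ) : E →L[ℝ] E)‖ + 1)⁻¹, by positivity, fun x => ?_⟩
  rw [inv_mul_le_iff₀ (by positivity)]
  have h1 : ((a⁻¹ : (E →L[ℝ] E)ˣ) : E →L[ℝ] E) ((a : E →L[ℝ] E) x) = x := by
    rw [← mul_apply_eq_comp, Units.inv_mul]; rfl
  calc ‖x‖ = ‖((a⁻¹ : (E →L[ℝ] E)ˣ) : E →L[ℝ] E) ((a : E →L[ℝ] E) x)‖ := by rw [h1]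
    _ ≤ ‖((a⁻¹ : (E →L[ℝ] E)ˣ) : E →L[ℝ] E)‖ * ‖(a : E →L[ℝ] E) x‖ :=
      ContinuousLinearMap.le_opNorm _ _
    _ ≤ _ := by gcongr; linarith

lemma mem_spectrum_iff_not_isUnit_sub {T : E →L[ℝ] E} {t : ℝ} :
    t ∈ spectrum ℝ T ↔ ¬ IsUnit (T - algebraMap ℝ (E →L[ℝ] E) t) := by
  rw [spectrum.mem_iff, ← IsUnit.neg_iff, neg_sub]

lemma sub_algebraMap_apply (T : E →L[ℝ] E) (t : ℝ) (x : E) :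
    (T - algebraMap ℝ (E →L[ℝ] E) t) x = T x - t • x := by
  simp [Algebra.algebraMap_eq_smul_one]

variable [CompleteSpace E]

lemma isUnit_of_bounded_below {A : E →L[ℝ] E} (hA : IsSelfAdjoint A) {c : ℝ} (hc : 0 < c)
    (h : ∀ x, c * ‖x‖ ≤ ‖A x‖) : IsUnit A := by
  rw [ContinuousLinearMap.isUnit_iff_bijective,
    ContinuousLinearMap.bijective_iff_dense_range_and_antilipschitz]
  refine ⟨?_, (Real.toNNReal c)⁻¹, A.antilipschitz_of_bound fun x => ?_⟩
  · rw [Submodule.topologicalClosure_eq_top_iff, Submodule.eq_bot_iff]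
    intro x hx
    rw [ContinuousLinearMap.orthogonal_range, hA.adjoint_eq] at hx
    have h0 : A x = 0 := by simpa using hx
    have := h x
    rw [h0, norm_zero] at this
    exact norm_le_zero_iff.1 (nonpos_of_mul_nonpos_right this hc)
  · have := h x
    rw [NNReal.coe_inv, Real.coe_toNNReal c hc.le, inv_mul_eq_div, le_div_iff₀ hc]
    linarith

lemma isSelfAdjoint_sub_algebraMap {T : E →L[ℝ] E} (hT : IsSelfAdjoint T) (t : ℝ) :
    IsSelfAdjoint (T - algebraMap ℝ (E →L[ℝ] E) t) :=
  hT.sub (IsSelfAdjoint.algebraMap _ (IsSelfAdjoint.all t))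

/-- Weyl's criterion for self-adjoint operators, in quantitative form. -/
lemma exists_approx_eigenvector {T : E →L[ℝ] E} (hT : IsSelfAdjoint T) {t : ℝ}
    (ht : t ∈ spectrum ℝ T) {ε : ℝ} (hε : 0 < ε) : ∃ x, ‖T x - t • x‖ < ε * ‖x‖ := by
  by_contra! h
  refine mem_spectrum_iff_not_isUnit_sub.1 ht
    (isUnit_of_bounded_below (isSelfAdjoint_sub_algebraMap hT t) hε fun x => ?_)
  rw [sub_algebraMap_apply]
  exact h x

lemma norm_mem_spectrum_or_neg {S : E →L[ℝ] E} (hS : IsSelfAdjoint S) (h0 : 0 < ‖S‖) :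
    ‖S‖ ∈ spectrum ℝ S ∨ -‖S‖ ∈ spectrum ℝ S := by
  by_contra! h
  obtain ⟨h1, h2⟩ := h
  rw [mem_spectrum_iff_not_isUnit_sub, not_not] at h1 h2
  obtain ⟨c, hc, hb⟩ := exists_bounded_below_of_isUnit (h1.mul h2)
  set s := ‖S‖ with hs
  have key : ∀ x, s ^ 2 * ‖S x‖ ^ 2 ≤ (s ^ 4 - c ^ 2) * ‖x‖ ^ 2 := by
    intro x
    have e : ((S - algebraMap ℝ (E →L[ℝ] E) s) * (S - algebraMap ℝ (E →L[ℝ] E) (-s))) x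
        = S (S x) - s ^ 2 • x := by
      rw [mul_apply_eq_comp, sub_algebraMap_apply, sub_algebraMap_apply]
      simp only [map_sub, map_smul]
      module
    have hx := hb x
    rw [e] at hx
    have hsq : (c * ‖x‖) ^ 2 ≤ ‖S (S x) - s ^ 2 • x‖ ^ 2 := by gcongr
    rw [norm_sub_sq_real, inner_smul_right, norm_smul] at hsq
    have hsym : inner ℝ (S (S x)) x = ‖S x‖ ^ 2 := by
      rw [← real_inner_self_eq_norm_sq]
      exact hS.isSymmetric (S x) x
    have hSS : ‖S (S x)‖ ^ 2 ≤ (s * ‖S x‖) ^ 2 := by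
      gcongr
      exact S.le_opNorm _
    rw [hsym, Real.norm_of_nonneg (by positivity)] at hsq
    nlinarith
  have hle : s ≤ √((s ^ 4 - c ^ 2) / s ^ 2) := by
    refine S.opNorm_le_bound (Real.sqrt_nonneg _) fun x => ?_
    rcases eq_or_ne x 0 with rfl | hx
    · simp
    have hx' : 0 < ‖x‖ := norm_pos_iff.2 hx
    have hk := key x
    rw [← div_le_iff₀ hx']
    refine Real.le_sqrt_of_sq_le ?_
    rw [div_pow, div_le_div_iff₀ (by positivity) (by positivity)]
    linarith
  have hpos : 0 < √((s ^ 4 - c ^ 2) / s ^ 2) := h0.trans_le hle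
  have h3 := Real.sqrt_pos.1 hpos
  have h4 := (Real.le_sqrt h0.le h3.le).1 hle
  rw [le_div_iff₀ (by positivity)] at h4
  nlinarith

/-- An approximate eigenvector of a self-adjoint operator forces a nearby point of the spectrum. -/
lemma exists_mem_spectrum_near {T : E →L[ℝ] E} (hT : IsSelfAdjoint T) {t ε : ℝ} {x : E}
    (hx : ‖T x - t • x‖ < ε * ‖x‖) : ∃ s ∈ spectrum ℝ T, |s - t| < ε := by
  have hx0 : 0 < ‖x‖ := by
    rcases (norm_nonneg x).eq_or_lt with h | h
    · rw [← h] at hx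
      have := norm_nonneg (T x - t • x)
      linarith
    · exact h
  have hε : 0 < ε := by
    have := (norm_nonneg _).trans_lt hx
    exact pos_of_mul_pos_left this hx0.le
  by_cases hu : IsUnit (T - algebraMap ℝ (E →L[ℝ] E) t)
  swap
  · exact ⟨t, mem_spectrum_iff_not_isUnit_sub.2 hu, by simpa⟩
  have hA := isSelfAdjoint_sub_algebraMap hT t
  obtain ⟨a, ha⟩ := hu
  set S : E →L[ℝ] E := ((a⁻¹ : (E →L[ℝ] E)ˣ) : E →L[ℝ] E) with hSdef
  rw [← sub_algebraMap_apply, ← ha] at hx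
  have hSa : S ((a : E →L[ℝ] E) x) = x := by
    rw [← mul_apply_eq_comp, Units.inv_mul]; rfl
  have hle : ‖x‖ ≤ ‖S‖ * ‖(a : E →L[ℝ] E) x‖ := by
    conv_lhs => rw [← hSa]
    exact S.le_opNorm _
  have hS0 : 0 < ‖S‖ := by
    rcases (norm_nonneg S).eq_or_lt with h | h
    · rw [← h] at hle; linarith
    · exact h
  have hSε : ‖S‖⁻¹ < ε := by
    rw [inv_lt_iff_one_lt_mul₀ hS0]
    have h1 : ‖x‖ < ‖S‖ * (ε * ‖x‖) := hle.trans_lt (by gcongr)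
    by_contra! h2
    nlinarith
  have hSsa : IsSelfAdjoint S := by
    rw [← ha] at hA
    have h1 : star a = a := Units.ext hA
    have : star a⁻¹ = a⁻¹ := by rw [star_inv, h1]
    exact congrArg Units.val this
  have key : ∀ r : ℝ, |r| = ‖S‖ → r ∈ spectrum ℝ S → ∃ s ∈ spectrum ℝ T, |s - t| < ε := by
    intro r hr hrS
    have hr0 : r ≠ 0 := by
      rintro rfl
      simp at hr
      exact hS0.ne hr
    have h1 := (spectrum.inv_mem_iff (r := Units.mk0 r hr0) (a := a⁻¹)).1 hrS
    rw [inv_inv, ha] at h1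
    refine ⟨r⁻¹ + t, ?_, ?_⟩
    · rw [mem_spectrum_iff_not_isUnit_sub] at h1 ⊢
      convert h1 using 2
      rw [map_add]
      simp only [Units.val_inv_eq_inv_val, Units.val_mk0]
      abel
    · rw [add_sub_cancel_right, abs_inv, hr]
      exact hSε
  rcases norm_mem_spectrum_or_neg hSsa hS0 with h | h
  · exact key _ (abs_of_pos hS0) h
  · exact key _ (by rw [abs_neg, abs_of_pos hS0]) h

end Hilbert

section Operator

variable {d : ℕ}

lemma mem_nbhd {m n : Zd d} : m ∈ nbhd n ↔ dist1 n m = 1 := by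
  refine ⟨fun h => (Finset.mem_filter.1 h).2, fun h => Finset.mem_filter.2 ⟨?_, h⟩⟩
  rw [Fintype.mem_piFinset]
  intro i
  have h1 : |n i - m i| ≤ 1 := by
    rw [← h]
    exact Finset.single_le_sum (f := fun i => |n i - m i|) (fun _ _ => abs_nonneg _)
      (Finset.mem_univ i)
  rw [abs_le] at h1
  rw [Finset.mem_Icc]
  omega

lemma dist1_comm (m n : Zd d) : dist1 m n = dist1 n m := by
  simp only [dist1, abs_sub_comm]

lemma mem_nbhd_comm {m n : Zd d} : m ∈ nbhd n ↔ n ∈ nbhd m := by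
  rw [mem_nbhd, mem_nbhd, dist1_comm]

lemma mem_nbhd_sub {m n a : Zd d} : m - a ∈ nbhd (n - a) ↔ m ∈ nbhd n := by
  simp [mem_nbhd, dist1]

lemma sum_nbhd_sub (f : Zd d → ℝ) (n a : Zd d) :
    ∑ j ∈ nbhd (n - a), f j = ∑ j ∈ nbhd n, f (j - a) := by
  refine (Finset.sum_bij' (fun j _ => j - a) (fun j _ => j + a) ?_ ?_ ?_ ?_ ?_).symm
  · exact fun j hj => mem_nbhd_sub.2 hj
  · intro j hj
    rw [← mem_nbhd_sub (a := a)]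
    simpa using hj
  · simp
  · simp
  · simp

/-- A bounded operator on `ℓ²(ℤ^d)` that acts as `-Δ + V`. -/
def IsSchrodinger (V : Zd d → ℝ) (T : l2 d →L[ℝ] l2 d) : Prop :=
  ∀ (u : l2 d) (n : Zd d), (T u) n = (-∑ j ∈ nbhd n, u j) + V n * u n

lemma hasSum_lp_single (u : l2 d) : HasSum (fun n => lp.single 2 n (u n)) u :=
  lp.hasSum_single (by norm_num) u

lemma eq_of_forall_single {T S : l2 d →L[ℝ] l2 d}
    (h : ∀ n : Zd d, T (lp.single 2 n (1 : ℝ)) = S (lp.single 2 n (1 : ℝ))) : T = S := by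
  ext1 u
  have hs : ∀ n, T (lp.single 2 n (u n)) = S (lp.single 2 n (u n)) := by
    intro n
    have : (lp.single 2 n (u n) : l2 d) = u n • (lp.single 2 n (1 : ℝ) : l2 d) := by
      rw [← lp.single_smul, smul_eq_mul, mul_one]
    rw [this, map_smul, map_smul, h]
  have h1 := (hasSum_lp_single u).mapL T
  have h2 := (hasSum_lp_single u).mapL S
  simp only [hs] at h1
  exact h1.unique h2

lemma IsSchrodinger.isSelfAdjoint {V : Zd d → ℝ} {T : l2 d →L[ℝ] l2 d}
    (hT : IsSchrodinger V T) : IsSelfAdjoint T := by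
  rw [ContinuousLinearMap.isSelfAdjoint_iff']
  refine eq_of_forall_single fun n => ?_
  ext m
  have hinner : ∀ (w : l2 d) (k : Zd d), w k = inner ℝ (lp.single 2 k (1 : ℝ) : l2 d) w := by
    intro w k
    rw [lp.inner_single_left]
    simp
  rw [hinner _ m, ContinuousLinearMap.adjoint_inner_right, real_inner_comm, ← hinner, hT, hT]
  have hsum : ∀ k l : Zd d, ∑ j ∈ nbhd k, (lp.single 2 l (1 : ℝ) : l2 d) j
      = if l ∈ nbhd k then 1 else 0 := by
    intro k l
    simp only [lp.single_apply, Pi.single_apply, Finset.sum_ite_eq']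
  rw [hsum, hsum]
  simp only [mem_nbhd_comm (m := m)]
  congr 1
  rcases eq_or_ne n m with rfl | h
  · rfl
  · rw [lp.single_apply_ne _ _ _ h, lp.single_apply_ne _ _ _ h.symm]
    simp

lemma exists_translate (u : l2 d) (a : Zd d) :
    ∃ w : l2 d, (∀ n, w n = u (n - a)) ∧ ‖w‖ = ‖u‖ := by
  have h2 : 0 < (2 : ℝ≥0∞).toReal := by norm_num
  have hs := (lp.memℓp u).summable h2
  have hm : Memℓp (fun n => u (n - a)) 2 :=
    (memℓp_gen_iff h2).2 ((Equiv.subRight a).summable_iff.2 hs)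
  refine ⟨⟨_, hm⟩, fun n => rfl, ?_⟩
  rw [lp.norm_eq_tsum_rpow h2, lp.norm_eq_tsum_rpow h2]
  congr 1
  exact (Equiv.subRight a).tsum_eq fun n => ‖u n‖ ^ (2 : ℝ≥0∞).toReal

lemma IsSchrodinger.exists_finite_approx {V : Zd d → ℝ} {T : l2 d →L[ℝ] l2 d}
    (hT : IsSchrodinger V T) {t : ℝ} (ht : t ∈ spectrum ℝ T) {ε : ℝ} (hε : 0 < ε) :
    ∃ (F : Finset (Zd d)) (u : l2 d), (∀ n ∉ F, u n = 0) ∧ ‖T u - t • u‖ < ε * ‖u‖ := by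
  obtain ⟨u, hu⟩ := exists_approx_eigenvector hT.isSelfAdjoint ht hε
  have hopen : IsOpen {v : l2 d | ‖T v - t • v‖ < ε * ‖v‖} :=
    isOpen_lt (by fun_prop) (by fun_prop)
  obtain ⟨F, hF⟩ := ((hasSum_lp_single u).eventually (hopen.mem_nhds hu)).exists
  refine ⟨F, ∑ n ∈ F, lp.single 2 n (u n), fun n hn => ?_, hF⟩
  rw [lp.coeFn_sum, Finset.sum_apply]
  refine Finset.sum_eq_zero fun k hk => lp.single_apply_ne _ _ _ ?_
  rintro rfl
  exact hn hk

/-- If two potentials agree, up to a translation, on the support of an approximate eigenvector,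
then both spectra come close to the approximate eigenvalue. -/
lemma IsSchrodinger.exists_mem_spectrum_near {V V' : Zd d → ℝ} {T T' : l2 d →L[ℝ] l2 d}
    (hT : IsSchrodinger V T) (hT' : IsSchrodinger V' T') {F : Finset (Zd d)} {u : l2 d}
    (huF : ∀ n ∉ F, u n = 0) (a : Zd d) (hV : ∀ n ∈ F, V' (n + a) = V n) {t ε : ℝ}
    (hu : ‖T u - t • u‖ < ε * ‖u‖) : ∃ s ∈ spectrum ℝ T', |s - t| < ε := by
  obtain ⟨w, hw, hwn⟩ := exists_translate u a
  obtain ⟨z, hz, hzn⟩ := exists_translate (T u - t • u) a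
  refine _root_.exists_mem_spectrum_near hT'.isSelfAdjoint (x := w) ?_
  have : T' w - t • w = z := by
    ext n
    rw [hz, lp.coeFn_sub, lp.coeFn_sub, lp.coeFn_smul, lp.coeFn_smul]
    simp only [Pi.sub_apply, Pi.smul_apply, hT _ _, hT' _ _, hw, sum_nbhd_sub]
    congr 2
    by_cases hn : n - a ∈ F
    · rw [← hV _ hn, sub_add_cancel]
    · rw [huF _ hn, mul_zero, mul_zero]
  rwa [this, hzn, hwn]

end Operator

section Potential

variable {d : ℕ}

/-- The index of the cell of side lengths `M` that contains `n`. -/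
def cell (M n : Zd d) : Zd d := fun i => (n i - 1) / M i

lemma cell_add {M : Zd d} (hM : ∀ i, 0 < M i) (n j : Zd d) :
    cell M (n + fun i => j i * M i) = cell M n + j := by
  ext i
  simp only [cell, Pi.add_apply]
  rw [← Int.add_mul_ediv_right _ _ (hM i).ne']
  congr 1
  ring

lemma Vpot_eq {M b : Zd d} (hM : ∀ i, 0 < M i) {q : Zd d → ℝ}
    (hsupp : ∀ n, n ∉ dbox (fun _ => 1) b → q n = 0) {ω : Zd d → Zd d} (hω : adm M b ω)
    (n : Zd d) :
    Vpot M q ω n = q (fun i => n i - cell M n i * M i - ω (cell M n) i) := by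
  refine tsum_eq_single (cell M n) fun k hk => hsupp _ fun hmem => hk ?_
  rw [dbox, Fintype.mem_piFinset] at hmem
  ext i
  have h1 := Finset.mem_Icc.1 (hmem i)
  obtain ⟨h2, h3⟩ := hω k i
  refine (Int.ediv_eq_iff_of_pos (hM i)).2 ?_ |>.symm
  constructor <;> nlinarith [h1.1, h1.2]

lemma Vpot_translate {M b : Zd d} (hM : ∀ i, 0 < M i) {q : Zd d → ℝ}
    (hsupp : ∀ n, n ∉ dbox (fun _ => 1) b → q n = 0) {ω ω' : Zd d → Zd d}
    (hω : adm M b ω) (hω' : adm M b ω') {j n : Zd d} (h : ω' (cell M n + j) = ω (cell M n)) :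
    Vpot M q ω' (n + fun i => j i * M i) = Vpot M q ω n := by
  rw [Vpot_eq hM hsupp hω, Vpot_eq hM hsupp hω', cell_add hM, h]
  congr 1
  ext i
  simp only [Pi.add_apply]
  ring

lemma exists_bound (s : Finset (Zd d)) : ∃ N : ℤ, 0 ≤ N ∧ ∀ k ∈ s, ∀ i, |k i| ≤ N := by
  refine ⟨∑ k ∈ s, ∑ i, |k i|, by positivity, fun k hk i => ?_⟩
  calc |k i| ≤ ∑ i, |k i| :=
        Finset.single_le_sum (f := fun i => |k i|) (fun _ _ => abs_nonneg _) (Finset.mem_univ i)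
    _ ≤ _ := Finset.single_le_sum (f := fun k : Zd d => ∑ i, |k i|)
        (fun _ _ => by positivity) hk

/-- Every configuration agrees on a given finite set with a periodic one taking no new values. -/
lemma exists_periodic (ω : Zd d → Zd d) (s : Finset (Zd d)) :
    ∃ ω', IsPerConf ω' ∧ (∀ k ∈ s, ω' k = ω k) ∧ ∀ k, ∃ l, ω' k = ω l := by
  obtain ⟨N, hN, hs⟩ := exists_bound s
  refine ⟨fun k => ω fun i => (k i + N) % (2 * N + 1) - N,
    ⟨fun _ => 2 * N + 1, fun _ => by positivity, fun n j => ?_⟩, fun k hk => ?_, fun k => ⟨_, rfl⟩⟩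
  · refine congrArg ω (funext fun i => ?_)
    rw [add_right_comm, Int.add_mul_emod_self_right]
  · refine congrArg ω (funext fun i => ?_)
    have := abs_le.1 (hs k hk i)
    rw [Int.emod_eq_of_lt (by omega) (by omega)]
    omega

end Potential

section Probability

variable {d : ℕ} {μ : Zd d → ℝ≥0∞} {P : Measure (Zd d → Zd d)}

lemma ae_apply_pos
    (hiid : ∀ (s : Finset (Zd d)) (g : Zd d → Zd d),
      P {ω | ∀ k ∈ s, ω k = g k} = ∏ k ∈ s, μ (g k)) :
    ∀ᵐ ω ∂P, ∀ k, 0 < μ (ω k) := by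
  rw [ae_all_iff]
  intro k
  have h : ∀ᵐ ω ∂P, ∀ a : Zd d, μ a = 0 → ω k ≠ a := by
    rw [ae_all_iff]
    intro a
    by_cases ha : μ a = 0
    · have := hiid {k} fun _ => a
      simp only [Finset.mem_singleton, forall_eq, Finset.prod_singleton, ha] at this
      rw [ae_iff]
      simpa [ha] using this
    · simp [ha]
  filter_upwards [h] with ω hω
  exact pos_iff_ne_zero.2 fun h0 => hω _ h0 rfl

/-- Almost surely, every finite pattern of positive probability occurs somewhere. -/
lemma ae_exists_translate (hd : 1 ≤ d) [IsProbabilityMeasure P]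
    (hiid : ∀ (s : Finset (Zd d)) (g : Zd d → Zd d),
      P {ω | ∀ k ∈ s, ω k = g k} = ∏ k ∈ s, μ (g k))
    (s : Finset (Zd d)) (g : Zd d → Zd d) (hg : ∀ k ∈ s, 0 < μ (g k)) :
    ∀ᵐ ω ∂P, ∃ j, ∀ k ∈ s, ω (k + j) = g k := by
  classical
  obtain ⟨N, hN, hs⟩ := exists_bound s
  let j : ℕ → Zd d := fun m _ => m * (2 * N + 1)
  have hinj : Set.InjOn (fun p : ℕ × Zd d => p.2 + j p.1) {p | p.2 ∈ s} := by
    rintro ⟨m, k⟩ hk ⟨m', k'⟩ hk' h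
    have hmm : m = m' := by
      have h0 := congrFun h ⟨0, hd⟩
      have h1 := abs_le.1 (hs k hk ⟨0, hd⟩)
      have h2 := abs_le.1 (hs k' hk' ⟨0, hd⟩)
      simp only [Pi.add_apply, j] at h0
      by_contra hne
      rcases lt_or_gt_of_ne hne with hlt | hlt
      · have : (m : ℤ) + 1 ≤ m' := by exact_mod_cast hlt
        nlinarith
      · have : (m' : ℤ) + 1 ≤ m := by exact_mod_cast hlt
        nlinarith
    subst hmm
    simpa using h
  obtain ⟨G, hG⟩ : ∃ G : Zd d → Zd d, ∀ m, ∀ k ∈ s, G (k + j m) = g k := by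
    refine ⟨fun x => g (Function.invFunOn (fun p : ℕ × Zd d => p.2 + j p.1) {p | p.2 ∈ s} x).2,
      fun m k hk => ?_⟩
    have := hinj.leftInvOn_invFunOn (show ((m, k) : ℕ × Zd d) ∈ {p : ℕ × Zd d | p.2 ∈ s} from hk)
    simp only at this
    simp only [this]
  let A : ℕ → Set (Zd d → Zd d) := fun m => {ω | ∀ k ∈ s, ω (k + j m) = g k}
  have hAI : ∀ I : Finset ℕ, P (⋂ m ∈ I, A m) = ∏ _m ∈ I, ∏ k ∈ s, μ (g k) := by
    intro I
    have hset : (⋂ m ∈ I, A m)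
        = {ω | ∀ x ∈ (I ×ˢ s).image fun p : ℕ × Zd d => p.2 + j p.1, ω x = G x} := by
      ext ω
      simp only [A, Set.mem_iInter, Set.mem_ofPred_eq, Finset.forall_mem_image,
        Finset.mem_product, Prod.forall, and_imp]
      exact ⟨fun h m k hm hk => by rw [h m hm k hk, hG m k hk],
        fun h m hm k hk => by rw [h m k hm hk, hG m k hk]⟩
    rw [hset, hiid, Finset.prod_image fun p hp p' hp' h => hinj (Finset.mem_product.1 hp).2
      (Finset.mem_product.1 hp').2 h, Finset.prod_product]
    exact Finset.prod_congr rfl fun m _ => Finset.prod_congr rfl fun k hk => by rw [hG m k hk]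
  have hA : ∀ m, P (A m) = ∏ k ∈ s, μ (g k) := fun m => by simpa using hAI {m}
  have hmeas : ∀ m, MeasurableSet (A m) := by
    intro m
    have : A m = ⋂ k ∈ s, (fun ω : Zd d → Zd d => ω (k + j m)) ⁻¹' {g k} := by
      ext ω
      simp [A]
    rw [this]
    exact Finset.measurableSet_biInter _ fun k _ =>
      measurable_pi_apply _ (measurableSet_singleton _)
  have hind : ProbabilityTheory.iIndepSet A P :=
    (ProbabilityTheory.iIndepSet_iff_meas_biInter hmeas).2 fun I => by
      rw [hAI I]
      exact Finset.prod_congr rfl fun m _ => (hA m).symm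
  have hsum : ∑' m, P (A m) = ∞ := by
    simp only [hA]
    exact ENNReal.tsum_const_eq_top_of_ne_zero
      (Finset.prod_ne_zero_iff.2 fun k hk => (hg k hk).ne')
  have hlim := ProbabilityTheory.measure_limsup_eq_one hmeas hind hsum
  have hae := (prob_compl_eq_zero_iff (MeasurableSet.measurableSet_limsup hmeas)).2 hlim
  filter_upwards [compl_mem_ae_iff.2 hae] with ω hω
  rw [compl_compl, Filter.mem_limsup_iff_frequently_mem] at hω
  obtain ⟨m, hm⟩ := hω.exists
  exact ⟨j m, hm⟩

lemma ae_forall_exists_translate (hd : 1 ≤ d) [IsProbabilityMeasure P]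
    (hiid : ∀ (s : Finset (Zd d)) (g : Zd d → Zd d),
      P {ω | ∀ k ∈ s, ω k = g k} = ∏ k ∈ s, μ (g k)) :
    ∀ᵐ ω ∂P, ∀ (s : Finset (Zd d)) (g : Zd d → Zd d), (∀ k ∈ s, 0 < μ (g k)) →
      ∃ j, ∀ k ∈ s, ω (k + j) = g k := by
  classical
  have h : ∀ᵐ ω ∂P, ∀ (s : Finset (Zd d)) (g : s → Zd d), (∀ k, 0 < μ (g k)) →
      ∃ j, ∀ k : s, ω (k + j) = g k := by
    rw [ae_all_iff]
    intro s
    rw [ae_all_iff]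
    intro g
    by_cases hg : ∀ k, 0 < μ (g k)
    · have := ae_exists_translate hd hiid s (fun k => if hk : k ∈ s then g ⟨k, hk⟩ else 0)
        fun k hk => by simpa [hk] using hg ⟨k, hk⟩
      filter_upwards [this] with ω hω _
      obtain ⟨j, hj⟩ := hω
      exact ⟨j, fun k => by simpa using hj k k.2⟩
    · exact Filter.Eventually.of_forall fun ω h => absurd h hg
  filter_upwards [h] with ω hω s g hg
  obtain ⟨j, hj⟩ := hω s (fun k => g k) fun k => hg k k.2
  exact ⟨j, fun k hk => hj ⟨k, hk⟩⟩

end Probability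

/-- **Deterministic spectrum of the random displacement model.**  Let the `ω_k` be
i.i.d. with distribution `μ` on `Δ` (expressed through the cylinder-set condition on
the product measure `ℙ`).  Then for `ℙ`-almost every `ω`,
`σ(h_ω) = Σ = closure( ⋃_{ω' ∈ C_per} σ(h_{ω'}) )`, where `C_per` is the set of periodic
admissible configurations all of whose displacements have positive `μ`-probability. -/
theorem deterministic_spectrum
    (d : ℕ) (hd : 1 ≤ d) (M b : Zd d)
    (hb : ∀ i, 1 ≤ b i) (hbM : ∀ i, b i ≤ M i)
    (q : Zd d → ℝ)
    (hsupp : ∀ n, n ∉ dbox (fun _ => 1) b → q n = 0)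
    (μ : Zd d → ℝ≥0∞)
    (hμsupp : ∀ a : Zd d, ¬ (∀ i, 0 ≤ a i ∧ a i ≤ M i - b i) → μ a = 0)
    (hμtot : ∑ a ∈ dbox (fun _ => 0) (fun i => M i - b i), μ a = 1)
    (P : Measure (Zd d → Zd d)) [IsProbabilityMeasure P]
    (hiid : ∀ (s : Finset (Zd d)) (g : Zd d → Zd d),
      P {ω | ∀ k ∈ s, ω k = g k} = ∏ k ∈ s, μ (g k))
    (H : (Zd d → Zd d) → (l2 d →L[ℝ] l2 d))
    (hH : ∀ ω, adm M b ω → ∀ (u : l2 d) (n : Zd d),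
      (H ω u) n = (-∑ j ∈ nbhd n, u j) + Vpot M q ω n * u n) :
    ∀ᵐ ω ∂P, spectrum ℝ (H ω) =
      closure (⋃ ω' ∈ {ω' : Zd d → Zd d |
        adm M b ω' ∧ IsPerConf ω' ∧ ∀ k, 0 < μ (ω' k)}, spectrum ℝ (H ω')) := by
  have hM : ∀ i, 0 < M i := fun i => (hb i).trans (hbM i)
  have hadm : ∀ ω : Zd d → Zd d, (∀ k, 0 < μ (ω k)) → adm M b ω := fun ω hω k => by
    by_contra h
    exact (hω k).ne' (hμsupp _ h)
  have hS : ∀ ω, adm M b ω → IsSchrodinger (Vpot M q ω) (H ω) := hH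
  filter_upwards [ae_apply_pos hiid, ae_forall_exists_translate hd hiid] with ω hpos hpat
  have hω := hadm ω hpos
  refine Set.Subset.antisymm (fun t ht => ?_)
    (closure_minimal (Set.iUnion₂_subset fun ω' hω' t ht => ?_) (spectrum.isClosed (H ω)))
  · rw [Metric.mem_closure_iff]
    intro ε hε
    obtain ⟨F, u, huF, hu⟩ := (hS ω hω).exists_finite_approx ht hε
    obtain ⟨ω', hper, heq, hval⟩ := exists_periodic ω (F.image (cell M))
    have hpos' : ∀ k, 0 < μ (ω' k) := fun k => by
      obtain ⟨l, hl⟩ := hval k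
      rw [hl]
      exact hpos l
    have hω' := hadm ω' hpos'
    obtain ⟨r, hr, hrt⟩ := (hS ω hω).exists_mem_spectrum_near (hS ω' hω') huF
      (fun i => (0 : Zd d) i * M i)
      (fun n hn => Vpot_translate hM hsupp hω hω'
        (by rw [add_zero]; exact heq _ (Finset.mem_image_of_mem _ hn))) hu
    refine ⟨r, Set.mem_biUnion (⟨hω', hper, hpos'⟩ : ω' ∈ {ω' : Zd d → Zd d |
      adm M b ω' ∧ IsPerConf ω' ∧ ∀ k, 0 < μ (ω' k)}) hr, ?_⟩
    rwa [dist_comm, Real.dist_eq]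
  · rw [← (spectrum.isClosed (H ω)).closure_eq, Metric.mem_closure_iff]
    intro ε hε
    obtain ⟨hω'adm, -, hpos'⟩ := hω'
    obtain ⟨F, u, huF, hu⟩ := (hS ω' hω'adm).exists_finite_approx ht hε
    obtain ⟨j, hj⟩ := hpat (F.image (cell M)) ω' fun k _ => hpos' k
    obtain ⟨r, hr, hrt⟩ := (hS ω' hω'adm).exists_mem_spectrum_near (hS ω hω) huF
      (fun i => j i * M i)
      (fun n hn => Vpot_translate hM hsupp hω'adm hω (hj _ (Finset.mem_image_of_mem _ hn))) hu
    exact ⟨r, hr, by rwa [dist_comm, Real.dist_eq]⟩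
end
end

section
/- Assume (H2): μ({n}) > 0 for every corner n of Δ (i.e. every n ∈ Δ with n_i ∈ {0, M_i−b_i} for all i). Assume also (H1) and the hypotheses of the spectral minimization and maximization results: either d ≥ 2 and q ≠ 0 is sign-definite, or d = 1 and both min σ(h^N_{0,Λ}+q_a) ≠ −2 and min σ(h^N_{0,Λ}−q_a) ≠ −2 for at least one a each. Then for ℙ-almost every ω ∈ Ω, inf σ(h_ω) = min σ(h_{ω*}) and sup σ(h_ω) = max σ(h_{ω*}). -/
open scoped BigOperators ENNReal
open MeasureTheory

noncomputable section

/-- `n_S(i)`: the number of nearest neighbors of `i` lying outside `S`. -/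
def nOut {d : ℕ} (S : Finset (Zd d)) (i : Zd d) : ℕ :=
  ((nbhd i).filter fun j => j ∉ S).card

/-- The matrix of the Neumann Laplacian `h^N_{0,S}` plus a potential `V` on `S`. -/
def neumannMat {d : ℕ} (S : Finset (Zd d)) (V : Zd d → ℝ) : Matrix S S ℝ :=
  fun i j => (if dist1 (i : Zd d) (j : Zd d) = 1 then (-1 : ℝ) else 0)
    + (if i = j then (V (i : Zd d) - (nOut S (i : Zd d) : ℝ)) else 0)

/-- `E_0(a) = min σ(h^N_{0,Λ} + q_a)` for `Λ = ∏ [1, M i]`. -/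
def E0 {d : ℕ} (M : Zd d) (q : Zd d → ℝ) (a : Zd d) : ℝ :=
  sInf (spectrum ℝ (neumannMat (dbox (fun _ => 1) M) (fun n => q (n - a))))

/-- The special configuration `ω*`: `(ω*_k)_i = 0` if `k_i` is even, `M_i - b_i` if odd. -/
def ωstar {d : ℕ} (M b : Zd d) : Zd d → Zd d :=
  fun k i => if Even (k i) then 0 else M i - b i

section Spectral

variable {F : Type*} [NormedAddCommGroup F] [InnerProductSpace ℝ F]

/-- The inner product form of a nonnegative symmetric operator controls `‖S u‖ ^ 2`. -/
theorem norm_apply_sq_le_inner (S : F →L[ℝ] F) (hS : ∀ u v, inner ℝ (S u) v = inner ℝ u (S v))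
    (hpos : ∀ u, 0 ≤ inner ℝ (S u) u) (u : F) :
    ‖S u‖ ^ 2 ≤ (‖S‖ + 1) * inner ℝ (S u) u := by
  set K := ‖S‖ + 1 with hK
  have hK0 : 0 < K := by positivity
  have h1 := hpos (K • u - S u)
  have h2 : inner ℝ (S (S u)) (S u) ≤ ‖S‖ * ‖S u‖ ^ 2 := by
    calc inner ℝ (S (S u)) (S u) ≤ ‖S (S u)‖ * ‖S u‖ := real_inner_le_norm _ _
      _ ≤ (‖S‖ * ‖S u‖) * ‖S u‖ := by gcongr; exact S.le_opNorm _
      _ = _ := by ring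
  have h3 : inner ℝ (S (K • u - S u)) (K • u - S u)
      = K ^ 2 * inner ℝ (S u) u - 2 * K * ‖S u‖ ^ 2 + inner ℝ (S (S u)) (S u) := by
    rw [map_sub, map_smul]
    simp only [inner_sub_left, inner_sub_right, real_inner_smul_left, real_inner_smul_right]
    rw [hS (S u) u, real_inner_self_eq_norm_sq]
    ring
  rw [h3] at h1
  have h4 : K * ‖S u‖ ^ 2 ≤ K * (K * inner ℝ (S u) u) := by nlinarith [sq_nonneg ‖S u‖]
  exact le_of_mul_le_mul_left h4 hK0

variable [CompleteSpace F]

theorem le_of_mem_spectrum_of_le_inner (T : F →L[ℝ] F) {c : ℝ}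
    (h : ∀ u, c * ‖u‖ ^ 2 ≤ inner ℝ (T u) u) {l : ℝ} (hl : l ∈ spectrum ℝ T) : c ≤ l := by
  by_contra hlt
  push Not at hlt
  apply hl
  have hu : IsUnit (T - algebraMap ℝ (F →L[ℝ] F) l) := by
    refine ContinuousLinearMap.isUnit_of_forall_le_norm_inner_map _
      (c := (c - l).toNNReal) (by simpa using hlt) fun x => ?_
    have h1 : inner ℝ ((T - algebraMap ℝ (F →L[ℝ] F) l) x) x = inner ℝ (T x) x - l * ‖x‖ ^ 2 := by
      rw [_root_.sub_apply, inner_sub_left, ContinuousLinearMap.algebraMap_apply,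
        real_inner_smul_left, real_inner_self_eq_norm_sq]
    rw [h1]
    refine le_trans ?_ (le_abs_self _)
    have := h x
    rw [Real.coe_toNNReal _ (sub_nonneg.2 hlt.le)]
    linarith
  have := hu.neg
  rwa [neg_sub] at this

/-- The bottom of the spectrum of a bounded symmetric operator is the greatest lower bound of its
quadratic form. -/
theorem le_sInf_spectrum_iff [Nontrivial F] (T : F →L[ℝ] F)
    (hT : ∀ u v, inner ℝ (T u) v = inner ℝ u (T v)) (c : ℝ) :
    c ≤ sInf (spectrum ℝ T) ↔ ∀ u, c * ‖u‖ ^ 2 ≤ inner ℝ (T u) u := by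
  set A : Set ℝ := (fun u => inner ℝ (T u) u) '' {u : F | ‖u‖ = 1} with hA
  have hAne : A.Nonempty := by
    obtain ⟨u, hu⟩ := exists_norm_eq F zero_le_one
    exact ⟨_, u, hu, rfl⟩
  have hAbdd : BddBelow A := by
    refine ⟨-‖T‖, ?_⟩
    rintro _ ⟨u, hu, rfl⟩
    have h1 := abs_real_inner_le_norm (T u) u
    have h2 := T.le_opNorm u
    replace hu : ‖u‖ = 1 := hu
    rw [hu, mul_one] at h1 h2
    have := neg_abs_le (inner ℝ (T u) u)
    dsimp only
    linarith
  set m := sInf A with hm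
  have key : ∀ c', (c' ≤ m ↔ ∀ u, c' * ‖u‖ ^ 2 ≤ inner ℝ (T u) u) := by
    intro c'
    constructor
    · intro hc u
      rcases eq_or_ne u 0 with rfl | hu
      · simp
      have hn : ‖u‖ ≠ 0 := norm_ne_zero_iff.mpr hu
      have h1 : inner ℝ (T ((‖u‖⁻¹ : ℝ) • u)) ((‖u‖⁻¹ : ℝ) • u) ∈ A :=
        ⟨_, by simp [norm_smul, hn], rfl⟩
      have h2 := hc.trans (csInf_le hAbdd h1)
      rw [map_smul, real_inner_smul_left, real_inner_smul_right] at h2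
      have h3 : c' * ‖u‖ ^ 2 ≤ (‖u‖⁻¹ * (‖u‖⁻¹ * inner ℝ (T u) u)) * ‖u‖ ^ 2 := by gcongr
      refine h3.trans (le_of_eq ?_)
      field_simp
    · intro h
      refine le_csInf hAne ?_
      rintro _ ⟨u, hu, rfl⟩
      have := h u
      replace hu : ‖u‖ = 1 := hu
      simpa [hu] using this
  have hmform := (key m).1 le_rfl
  have hmem : m ∈ spectrum ℝ T := by
    intro hunit
    set S : F →L[ℝ] F := T - algebraMap ℝ (F →L[ℝ] F) m with hSdef
    have hu : IsUnit S := by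
      have := IsUnit.neg hunit
      rwa [neg_sub] at this
    have hSapp : ∀ x, S x = T x - m • x := by
      intro x
      rw [hSdef, _root_.sub_apply, ContinuousLinearMap.algebraMap_apply]
    have hSin : ∀ x, inner ℝ (S x) x = inner ℝ (T x) x - m * ‖x‖ ^ 2 := by
      intro x
      rw [hSapp, inner_sub_left, real_inner_smul_left, real_inner_self_eq_norm_sq]
    have hSsym : ∀ u v, inner ℝ (S u) v = inner ℝ u (S v) := by
      intro u v
      rw [hSapp, hSapp, inner_sub_left, inner_sub_right, hT, real_inner_smul_left,
        real_inner_smul_right]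
    have hSpos : ∀ u, 0 ≤ inner ℝ (S u) u := fun u => by
      rw [hSin]; linarith [hmform u]
    obtain ⟨R, hR⟩ := hu.exists_left_inv
    have hRS : ∀ u, R (S u) = u := fun u => by
      have := congrArg (fun X : F →L[ℝ] F => X u) hR
      simpa using this
    set K := (‖R‖ + 1) ^ 2 * (‖S‖ + 1) with hK
    have hK0 : 0 < K := by positivity
    have hbound : ∀ u, ‖u‖ ^ 2 ≤ K * inner ℝ (S u) u := by
      intro u
      have h1 : ‖u‖ ≤ (‖R‖ + 1) * ‖S u‖ := by
        have := R.le_opNorm (S u)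
        rw [hRS] at this
        nlinarith [norm_nonneg (S u)]
      calc ‖u‖ ^ 2 ≤ ((‖R‖ + 1) * ‖S u‖) ^ 2 := by gcongr
        _ = (‖R‖ + 1) ^ 2 * ‖S u‖ ^ 2 := by ring
        _ ≤ (‖R‖ + 1) ^ 2 * ((‖S‖ + 1) * inner ℝ (S u) u) := by
            gcongr; exact norm_apply_sq_le_inner S hSsym hSpos u
        _ = _ := by ring
    have hlt : m + K⁻¹ ≤ m := by
      rw [key]
      intro u
      have h1 := hbound u
      rw [hSin] at h1
      have h2 : K⁻¹ * ‖u‖ ^ 2 ≤ K⁻¹ * (K * (inner ℝ (T u) u - m * ‖u‖ ^ 2)) := by gcongr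
      rw [inv_mul_cancel_left₀ hK0.ne'] at h2
      linarith
    have : 0 < K⁻¹ := by positivity
    linarith
  have hInf : sInf (spectrum ℝ T) = m :=
    IsLeast.csInf_eq ⟨hmem, fun l hl => le_of_mem_spectrum_of_le_inner T hmform hl⟩
  rw [hInf, key]

/-- The top of the spectrum of a bounded symmetric operator is the least upper bound of its
quadratic form. -/
theorem sSup_spectrum_le_iff [Nontrivial F] (T : F →L[ℝ] F)
    (hT : ∀ u v, inner ℝ (T u) v = inner ℝ u (T v)) (c : ℝ) :
    sSup (spectrum ℝ T) ≤ c ↔ ∀ u, inner ℝ (T u) u ≤ c * ‖u‖ ^ 2 := by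
  have h := le_sInf_spectrum_iff (-T) (fun u v => by simp [hT]) (-c)
  rw [← spectrum.neg_eq, Real.sInf_neg, neg_le_neg_iff] at h
  rw [h]
  refine forall_congr' fun u => ?_
  simp

end Spectral

section LatticeForm

variable {d : ℕ}

/-- The `i`-th coordinate vector of `ℤ^d`. -/
def coordVec (i : Fin d) : Zd d := Pi.single i 1

theorem coordVec_self (i : Fin d) : coordVec i i = 1 := by simp [coordVec]

theorem coordVec_of_ne {i j : Fin d} (h : j ≠ i) : coordVec i j = 0 := by simp [coordVec, h]

theorem coordVec_apply (i j : Fin d) : coordVec i j = if j = i then 1 else 0 := by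
  simp [coordVec, Pi.single_apply]

theorem dist1_eq_one_iff (n m : Zd d) :
    dist1 n m = 1 ↔ ∃ i, m = n + coordVec i ∨ m = n - coordVec i := by
  constructor
  · intro h
    have hne : ∃ i, n i ≠ m i := by
      by_contra! hc
      simp [dist1, hc] at h
    obtain ⟨i, hi⟩ := hne
    rw [dist1, ← Finset.add_sum_erase _ _ (Finset.mem_univ i)] at h
    have h1 : 1 ≤ |n i - m i| := Int.one_le_abs (sub_ne_zero.2 hi)
    have h2 : ∀ j ∈ Finset.univ.erase i, 0 ≤ |n j - m j| := fun j _ => abs_nonneg _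
    have h3 := Finset.sum_nonneg h2
    have h4 : ∑ j ∈ Finset.univ.erase i, |n j - m j| = 0 := by omega
    rw [Finset.sum_eq_zero_iff_of_nonneg h2] at h4
    have h5 : ∀ j, j ≠ i → m j = n j := by
      intro j hj
      have := h4 j (by simp [hj])
      rw [abs_eq_zero] at this
      omega
    have h6 : |n i - m i| = 1 := by omega
    refine ⟨i, ?_⟩
    rcases (abs_eq zero_le_one).1 h6 with h7 | h7
    · right
      funext j
      by_cases hj : j = i
      · subst hj; simp [coordVec_self]; omega
      · simp [coordVec_of_ne hj, h5 j hj]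
    · left
      funext j
      by_cases hj : j = i
      · subst hj; simp [coordVec_self]; omega
      · simp [coordVec_of_ne hj, h5 j hj]
  · have hs : ∀ i : Fin d, ∑ j, |coordVec i j| = 1 := by
      intro i
      rw [Finset.sum_eq_single i]
      · simp [coordVec_self]
      · intro j _ hj; simp [coordVec_of_ne hj]
      · simp
    rintro ⟨i, rfl | rfl⟩
    · simp [dist1, hs]
    · simp [dist1, hs]

theorem mem_nbhd_iff (n m : Zd d) :
    m ∈ nbhd n ↔ ∃ i, m = n + coordVec i ∨ m = n - coordVec i := by
  rw [nbhd, Finset.mem_filter, dist1_eq_one_iff, and_iff_right_iff_imp]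
  rintro ⟨i, h⟩
  rw [Fintype.mem_piFinset]
  intro j
  have := coordVec_apply i j
  rcases h with rfl | rfl <;>
  · simp only [Finset.mem_Icc, Pi.add_apply, Pi.sub_apply]
    split_ifs at this <;> omega

theorem sum_nbhd (n : Zd d) (u : Zd d → ℝ) :
    ∑ j ∈ nbhd n, u j = ∑ i, (u (n + coordVec i) + u (n - coordVec i)) := by
  have h : nbhd n = Finset.univ.biUnion
      fun i : Fin d => ({n + coordVec i, n - coordVec i} : Finset (Zd d)) := by
    ext m
    simp [mem_nbhd_iff]
  have hne : ∀ i : Fin d, n + coordVec i ≠ n - coordVec i := by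
    intro i hi
    have := congrFun hi i
    simp [coordVec_self] at this
    omega
  rw [h, Finset.sum_biUnion]
  · exact Finset.sum_congr rfl fun i _ => Finset.sum_pair (hne i)
  · intro i _ j _ hij
    simp only [Function.onFun]
    rw [Finset.disjoint_left]
    intro m hm hm'
    simp only [Finset.mem_insert, Finset.mem_singleton] at hm hm'
    have h1 := coordVec_self i
    have h2 := coordVec_of_ne hij
    rcases hm with rfl | rfl <;> rcases hm' with h' | h' <;>
    · have := congrFun h' i
      simp only [Pi.add_apply, Pi.sub_apply] at this
      omega

/-- The energy density at `n` of `u` for the lattice Laplacian with potential `V`. -/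
def gradDens (V u : Zd d → ℝ) (n : Zd d) : ℝ :=
  ∑ i, (u (n + coordVec i) - u n) ^ 2 + V n * u n ^ 2

/-- Nonnegativity of the form of the (graph) Laplacian plus `V` on finitely supported functions. -/
def FormNonneg (V : Zd d → ℝ) : Prop :=
  ∀ u : Zd d → ℝ, u.support.Finite → 0 ≤ ∑' n, gradDens V u n

theorem support_shift_finite {u : Zd d → ℝ} (hu : u.support.Finite) (a : Zd d) :
    (fun n => u (n + a)).support.Finite :=
  hu.preimage (add_left_injective a).injOn

theorem summable_of_support_subset {f u : Zd d → ℝ} (hu : u.support.Finite)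
    (h : ∀ n, u n = 0 → f n = 0) : Summable f :=
  summable_of_hasFiniteSupport (hu.subset fun n hn h0 => hn (h n h0))

/-- Summation by parts: the form of the discrete Schrödinger operator with potential `V` is the
Dirichlet form with potential `V - 2 * d`. -/
theorem tsum_gradDens {u : Zd d → ℝ} (hu : u.support.Finite) (V : Zd d → ℝ) (c : ℝ) :
    ∑' n, gradDens (fun n => V n - 2 * d - c) u n
      = ∑' n, ((-∑ j ∈ nbhd n, u j) + V n * u n) * u n - c * ∑' n, u n ^ 2 := by
  obtain ⟨f, hf⟩ : ∃ f : Fin d → Zd d → ℝ,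
      ∀ i n, f i n = u n ^ 2 - u n * u (n - coordVec i) := ⟨_, fun _ _ => rfl⟩
  have hfs : ∀ i, Summable (f i) := fun i =>
    summable_of_support_subset hu fun n h => by simp [hf, h]
  have hfs' : ∀ i, Summable fun n => f i (n + coordVec i) := fun i =>
    (Equiv.addRight (coordVec i)).summable_iff.2 (hfs i)
  have hpt : ∀ n, gradDens (fun n => V n - 2 * d - c) u n
      = ((((-∑ j ∈ nbhd n, u j) + V n * u n) * u n) - c * u n ^ 2)
        + ∑ i, (f i (n + coordVec i) - f i n) := by
    intro n
    have h1 : (2 * d : ℝ) * u n ^ 2 = ∑ _i : Fin d, 2 * u n ^ 2 := by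
      simp; ring
    have h2 : gradDens (fun n => V n - 2 * d - c) u n
      = ∑ i, (u (n + coordVec i) - u n) ^ 2 - (2 * d : ℝ) * u n ^ 2 + V n * u n ^ 2
        - c * u n ^ 2 := by
      rw [gradDens]; ring
    rw [h2, h1, sum_nbhd, add_mul, neg_mul, Finset.sum_mul]
    have h3 : ∑ i, (u (n + coordVec i) - u n) ^ 2 - ∑ _i : Fin d, 2 * u n ^ 2
        = -∑ i, (u (n + coordVec i) + u (n - coordVec i)) * u n
          + ∑ i, (f i (n + coordVec i) - f i n) := by
      rw [← Finset.sum_sub_distrib, ← Finset.sum_neg_distrib, ← Finset.sum_add_distrib]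
      refine Finset.sum_congr rfl fun i _ => ?_
      simp only [hf, add_sub_cancel_right]
      ring
    linear_combination h3
  have hs1 : Summable fun n => ((-∑ j ∈ nbhd n, u j) + V n * u n) * u n :=
    summable_of_support_subset hu fun n h => by simp [h]
  have hs2 : Summable fun n => c * u n ^ 2 :=
    summable_of_support_subset hu fun n h => by simp [h]
  rw [tsum_congr hpt, Summable.tsum_add (hs1.sub hs2)
    (summable_sum fun i _ => (hfs' i).sub (hfs i)), hs1.tsum_sub hs2, tsum_mul_left,
    Summable.tsum_finsetSum fun i _ => (hfs' i).sub (hfs i)]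
  rw [Finset.sum_eq_zero, add_zero]
  intro i _
  rw [(hfs' i).tsum_sub (hfs i), sub_eq_zero]
  exact (Equiv.addRight (coordVec i)).tsum_eq (f i)

/-- The sign `(-1)^{n_1 + ⋯ + n_d}`. -/
def paritySign (n : Zd d) : ℝ := if Even (∑ i, n i) then 1 else -1

theorem paritySign_sq (n : Zd d) : paritySign n * paritySign n = 1 := by
  rw [paritySign]; split_ifs <;> norm_num

theorem sum_coordVec (i : Fin d) : ∑ j, coordVec i j = 1 := by
  simp [coordVec]

theorem paritySign_add (n : Zd d) (i : Fin d) : paritySign (n + coordVec i) = -paritySign n := by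
  simp only [paritySign, Pi.add_apply, Finset.sum_add_distrib, sum_coordVec, Int.even_add_one]
  split_ifs <;> simp_all

theorem paritySign_sub (n : Zd d) (i : Fin d) : paritySign (n - coordVec i) = -paritySign n := by
  have := paritySign_add (n - coordVec i) i
  rw [sub_add_cancel] at this
  rw [this, neg_neg]

theorem schrodinger_paritySign (V u : Zd d → ℝ) (n : Zd d) :
    ((-∑ j ∈ nbhd n, paritySign j * u j) + -V n * (paritySign n * u n)) * (paritySign n * u n)
      = -(((-∑ j ∈ nbhd n, u j) + V n * u n) * u n) := by
  have h : ∑ j ∈ nbhd n, paritySign j * u j = -paritySign n * ∑ j ∈ nbhd n, u j := by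
    rw [sum_nbhd n fun j => paritySign j * u j, sum_nbhd, Finset.mul_sum]
    refine Finset.sum_congr rfl fun i _ => ?_
    rw [paritySign_add, paritySign_sub]; ring
  rw [h]
  linear_combination ((∑ j ∈ nbhd n, u j) - V n * u n) * u n * paritySign_sq n

end LatticeForm

section Operator

variable {d : ℕ}

/-- The element of `ℓ²` given by the restriction of `u` to the finite set `s`. -/
def finToL2 (s : Finset (Zd d)) (u : Zd d → ℝ) : l2 d := ∑ n ∈ s, lp.single 2 n (u n)

theorem finToL2_apply (s : Finset (Zd d)) (u : Zd d → ℝ) (n : Zd d) :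
    finToL2 s u n = if n ∈ s then u n else 0 := by
  have h : finToL2 s u n = ∑ m ∈ s, (lp.single 2 m (u m) : l2 d) n := by
    rw [finToL2, AddSubgroup.val_finsetSum]
    exact Finset.sum_apply _ _ _
  rw [h]
  simp [lp.single_apply, Pi.single_apply]

theorem forall_l2_of_finite (T : l2 d →L[ℝ] l2 d) (c : ℝ)
    (h : ∀ u : Zd d → ℝ, u.support.Finite → ∀ v : l2 d, (∀ n, v n = u n) →
      c * ‖v‖ ^ 2 ≤ inner ℝ (T v) v) (v : l2 d) : c * ‖v‖ ^ 2 ≤ inner ℝ (T v) v := by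
  have ht : Filter.Tendsto (fun s => finToL2 s v) Filter.atTop (nhds v) :=
    lp.hasSum_single (by norm_num) v
  have hcont : Continuous fun w : l2 d => inner ℝ (T w) w - c * ‖w‖ ^ 2 := by fun_prop
  have := ge_of_tendsto' ((hcont.tendsto v).comp ht) (b := 0) fun s => by
    have := h (fun n => finToL2 s v n) ((Finset.finite_toSet s).subset fun n hn => by
      by_contra hns
      exact hn ((finToL2_apply s v n).trans (if_neg hns))) (finToL2 s v) fun n => rfl
    simp only [Function.comp_apply]
    linarith
  linarith

theorem l2_inner (u v : l2 d) : inner ℝ u v = ∑' n, v n * u n := by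
  rw [lp.inner_eq_tsum]; rfl

theorem l2_norm_sq (u : l2 d) : ‖u‖ ^ 2 = ∑' n, u n ^ 2 := by
  rw [← real_inner_self_eq_norm_sq, l2_inner]
  exact tsum_congr fun n => (sq _).symm

theorem summable_mul_of_summable_sq {ι : Type*} {f g : ι → ℝ} (hf : Summable fun n => f n ^ 2)
    (hg : Summable fun n => g n ^ 2) : Summable fun n => f n * g n := by
  refine Summable.of_norm_bounded (hf.add hg) fun n => ?_
  rw [Real.norm_eq_abs, abs_le]
  constructor <;> nlinarith [sq_nonneg (f n + g n), sq_nonneg (f n - g n)]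

theorem l2_summable_sq (u : l2 d) : Summable fun n => u n ^ 2 := by
  refine (lp.summable_inner (𝕜 := ℝ) u u).congr fun n => ?_
  rw [real_inner_self_eq_norm_sq, Real.norm_eq_abs, sq_abs]

theorem l2_summable_mul_shift (u v : l2 d) (a : Zd d) : Summable fun n => u (n + a) * v n :=
  summable_mul_of_summable_sq
    (f := fun n => u (n + a))
    ((Equiv.addRight a).summable_iff (f := fun n => u n ^ 2) |>.2 (l2_summable_sq u))
    (l2_summable_sq v)

/-- A discrete Schrödinger operator is symmetric. -/
theorem schrodinger_symm (T : l2 d →L[ℝ] l2 d) (V : Zd d → ℝ)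
    (hT : ∀ (u : l2 d) (n : Zd d), (T u) n = (-∑ j ∈ nbhd n, u j) + V n * u n) (u v : l2 d) :
    inner ℝ (T u) v = inner ℝ u (T v) := by
  have hsh := fun (u v : l2 d) (a : Zd d) => l2_summable_mul_shift u v a
  have hshift : ∀ (u v : l2 d) (a : Zd d),
      ∑' n, u (n + a) * v n = ∑' n, v (n - a) * u n := by
    intro u v a
    rw [← (Equiv.addRight a).tsum_eq fun n => v (n - a) * u n]
    exact tsum_congr fun n => by simp [mul_comm]
  have hs1 : ∀ u v : l2 d, Summable fun n => ∑ i, (u (n + coordVec i) * v n) := fun u v =>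
    summable_sum fun i _ => hsh u v _
  have hs2 : ∀ u v : l2 d, Summable fun n => ∑ i, (u (n - coordVec i) * v n) := fun u v =>
    summable_sum fun i _ => by simpa [sub_eq_add_neg] using hsh u v (-coordVec i)
  have hdiff : ∀ n, v n * (T u) n - (T v) n * u n
      = (∑ i, (v (n + coordVec i) * u n) - ∑ i, (u (n - coordVec i) * v n))
        + (∑ i, (v (n - coordVec i) * u n) - ∑ i, (u (n + coordVec i) * v n)) := by
    intro n
    rw [hT, hT, sum_nbhd, sum_nbhd]
    simp only [← Finset.sum_mul, Finset.sum_add_distrib]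
    ring
  rw [← sub_eq_zero, l2_inner, l2_inner, ← Summable.tsum_sub, tsum_congr hdiff,
    ((hs1 v u).sub (hs2 u v)).tsum_add ((hs2 v u).sub (hs1 u v)),
    (hs1 v u).tsum_sub (hs2 u v), (hs2 v u).tsum_sub (hs1 u v),
    Summable.tsum_finsetSum fun i _ => hsh v u _, Summable.tsum_finsetSum fun i _ => hsh u v _,
    Summable.tsum_finsetSum fun i _ => by simpa [sub_eq_add_neg] using hsh u v (-coordVec i),
    Summable.tsum_finsetSum fun i _ => by simpa [sub_eq_add_neg] using hsh v u (-coordVec i)]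
  · simp [hshift]
  · simpa using hsh v (T u) 0
  · simpa using hsh (T v) u 0

theorem forall_le_inner_iff_formNonneg (T : l2 d →L[ℝ] l2 d) (V : Zd d → ℝ)
    (hT : ∀ (u : l2 d) (n : Zd d), (T u) n = (-∑ j ∈ nbhd n, u j) + V n * u n) (c : ℝ) :
    (∀ u, c * ‖u‖ ^ 2 ≤ inner ℝ (T u) u) ↔ FormNonneg fun n => V n - 2 * d - c := by
  have hval : ∀ (u : Zd d → ℝ), u.support.Finite → ∀ v : l2 d, (∀ n, v n = u n) →
      ∑' n, gradDens (fun n => V n - 2 * d - c) u n = inner ℝ (T v) v - c * ‖v‖ ^ 2 := by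
    intro u hu v hv
    rw [tsum_gradDens hu, l2_norm_sq, l2_inner]
    simp only [hv, hT]
    congr 1
    exact tsum_congr fun n => mul_comm _ _
  constructor
  · intro h u hu
    have hv : ∀ n, finToL2 hu.toFinset u n = u n := fun n => by
      rw [finToL2_apply]
      split_ifs with hn
      · rfl
      · simpa [eq_comm] using hn
    rw [hval u hu _ hv]
    linarith [h (finToL2 hu.toFinset u)]
  · intro h
    refine forall_l2_of_finite T c fun u hu v hv => ?_
    have := h u hu
    rw [hval u hu v hv] at this
    linarith

instance : Nontrivial (l2 d) := by
  refine ⟨⟨lp.single 2 0 1, 0, fun h => ?_⟩⟩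
  have := congrArg (fun w : l2 d => w 0) h
  simp at this

theorem le_sInf_spectrum_iff_formNonneg (T : l2 d →L[ℝ] l2 d) (V : Zd d → ℝ)
    (hT : ∀ (u : l2 d) (n : Zd d), (T u) n = (-∑ j ∈ nbhd n, u j) + V n * u n) (c : ℝ) :
    c ≤ sInf (spectrum ℝ T) ↔ FormNonneg fun n => V n - 2 * d - c := by
  rw [le_sInf_spectrum_iff T (schrodinger_symm T V hT), forall_le_inner_iff_formNonneg T V hT]

theorem formNonneg_of_forall_paritySign {V : Zd d → ℝ} {c : ℝ}
    (h : ∀ u : Zd d → ℝ, u.support.Finite →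
      c * ∑' n, u n ^ 2 ≤ ∑' n, -(((-∑ j ∈ nbhd n, u j) + V n * u n) * u n)) :
    FormNonneg fun n => -V n - 2 * d - c := by
  intro u hu
  have h1 := h (fun n => paritySign n * u n) (hu.subset fun n hn h0 => hn (by simp [h0]))
  rw [tsum_gradDens hu fun n => -V n]
  have h2 : ∀ n, (paritySign n * u n) ^ 2 = u n ^ 2 := fun n => by
    linear_combination u n ^ 2 * paritySign_sq n
  have h3 : ∀ n, -(((-∑ j ∈ nbhd n, paritySign j * u j) + V n * (paritySign n * u n))
      * (paritySign n * u n)) = ((-∑ j ∈ nbhd n, u j) + -V n * u n) * u n := fun n => by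
    have := schrodinger_paritySign (fun n => -V n) u n
    simp only [neg_neg] at this
    rw [this, neg_neg]
  simp only [h2, h3] at h1
  linarith

theorem sSup_spectrum_le_iff_formNonneg (T : l2 d →L[ℝ] l2 d) (V : Zd d → ℝ)
    (hT : ∀ (u : l2 d) (n : Zd d), (T u) n = (-∑ j ∈ nbhd n, u j) + V n * u n) (c : ℝ) :
    sSup (spectrum ℝ T) ≤ c ↔ FormNonneg fun n => -V n - 2 * d - -c := by
  rw [sSup_spectrum_le_iff T (schrodinger_symm T V hT)]
  have hval : ∀ (u : Zd d → ℝ) (v : l2 d), (∀ n, v n = u n) →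
      inner ℝ (T v) v = ∑' n, ((-∑ j ∈ nbhd n, u j) + V n * u n) * u n := by
    intro u v hv
    rw [l2_inner]
    simp only [hv, hT]
    exact tsum_congr fun n => mul_comm _ _
  constructor
  · intro h
    refine formNonneg_of_forall_paritySign fun u hu => ?_
    have hv : ∀ n, finToL2 hu.toFinset u n = u n := fun n => by
      rw [finToL2_apply]
      split_ifs with hn
      · rfl
      · simpa [eq_comm] using hn
    have := h (finToL2 hu.toFinset u)
    rw [hval u _ hv, l2_norm_sq] at this
    simp only [hv] at this
    rw [tsum_neg]
    linarith
  · intro h u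
    have := forall_l2_of_finite (-T) (-c) (fun u hu v hv => ?_) u
    · simp only [_root_.neg_apply, inner_neg_left] at this
      linarith
    · have h1 := h (fun n => paritySign n * u n) (hu.subset fun n hn h0 => hn (by simp [h0]))
      rw [tsum_gradDens (V := fun n => -V n)
        (hu.subset fun n hn h0 => hn (by simp [h0]))] at h1
      have h2 : ∀ n, (paritySign n * u n) ^ 2 = u n ^ 2 := fun n => by
        linear_combination u n ^ 2 * paritySign_sq n
      simp only [h2, schrodinger_paritySign V u, tsum_neg] at h1
      rw [_root_.neg_apply, inner_neg_left, hval u v hv, l2_norm_sq]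
      simp only [hv]
      linarith

end Operator

section Cell

variable {d : ℕ}

theorem mem_dbox {lo hi n : Zd d} : n ∈ dbox lo hi ↔ ∀ i, lo i ≤ n i ∧ n i ≤ hi i := by
  simp [dbox, Fintype.mem_piFinset, Finset.mem_Icc]

/-- The energy density at `n` of `u` for the Neumann problem on `∏ [1, M i]` with potential `w`. -/
def cellDens (M : Zd d) (w u : Zd d → ℝ) (n : Zd d) : ℝ :=
  ∑ i, (if n i < M i then (u (n + coordVec i) - u n) ^ 2 else 0) + w n * u n ^ 2

/-- The form of the Neumann problem on `∏ [1, M i]` with potential `w`. -/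
def cellForm (M : Zd d) (w u : Zd d → ℝ) : ℝ := ∑ n ∈ dbox (fun _ => 1) M, cellDens M w u n

/-- The squared norm of `u` on `∏ [1, M i]`. -/
def cellSq (M : Zd d) (u : Zd d → ℝ) : ℝ := ∑ n ∈ dbox (fun _ => 1) M, u n ^ 2

theorem cellSq_nonneg (M : Zd d) (u : Zd d → ℝ) : 0 ≤ cellSq M u :=
  Finset.sum_nonneg fun _ _ => sq_nonneg _

theorem add_coordVec_mem_cell {M n : Zd d} (hn : n ∈ dbox (fun _ => 1) M) {i : Fin d}
    (hi : n i < M i) : n + coordVec i ∈ dbox (fun _ => 1) M := by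
  rw [mem_dbox] at hn ⊢
  intro j
  have h1 := hn j
  have h2 := coordVec_apply i j
  simp only [Pi.add_apply]
  split_ifs at h2 with h
  · subst h; omega
  · omega

theorem sub_coordVec_mem_cell {M n : Zd d} (hn : n ∈ dbox (fun _ => 1) M) {i : Fin d}
    (hi : 1 < n i) : n - coordVec i ∈ dbox (fun _ => 1) M := by
  rw [mem_dbox] at hn ⊢
  intro j
  have h1 := hn j
  have h2 := coordVec_apply i j
  simp only [Pi.sub_apply]
  split_ifs at h2 with h
  · subst h; omega
  · omega

theorem cellForm_congr {M : Zd d} {w w' u u' : Zd d → ℝ}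
    (hw : ∀ n ∈ dbox (fun _ => 1) M, w n = w' n) (hu : ∀ n ∈ dbox (fun _ => 1) M, u n = u' n) :
    cellForm M w u = cellForm M w' u' := by
  refine Finset.sum_congr rfl fun n hn => ?_
  rw [cellDens, cellDens, hw n hn, hu n hn]
  congr 1
  refine Finset.sum_congr rfl fun i _ => ?_
  split_ifs with hi
  · rw [hu _ (add_coordVec_mem_cell hn hi)]
  · rfl

theorem cellForm_smul (M : Zd d) (w u : Zd d → ℝ) (t : ℝ) :
    cellForm M w (fun n => t * u n) = t ^ 2 * cellForm M w u := by
  rw [cellForm, cellForm, Finset.mul_sum]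
  refine Finset.sum_congr rfl fun n _ => ?_
  rw [cellDens, cellDens, mul_add, Finset.mul_sum]
  congr 1
  · refine Finset.sum_congr rfl fun i _ => ?_
    split_ifs <;> ring
  · ring

theorem cellForm_sub_const (M : Zd d) (w u : Zd d → ℝ) (c : ℝ) :
    cellForm M (fun n => w n - c) u = cellForm M w u - c * cellSq M u := by
  rw [cellForm, cellForm, cellSq, Finset.mul_sum, ← Finset.sum_sub_distrib]
  refine Finset.sum_congr rfl fun n _ => ?_
  rw [cellDens, cellDens]; ring

theorem continuous_cellForm (M : Zd d) (w : Zd d → ℝ) : Continuous fun u => cellForm M w u := by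
  refine continuous_finsetSum _ fun n _ => ?_
  refine (continuous_finsetSum _ fun i _ => ?_).add (by fun_prop)
  split_ifs <;> fun_prop

theorem exists_cell_ground_state {M : Zd d} (hM : ∀ i, 1 ≤ M i) (w : Zd d → ℝ) :
    ∃ (E : ℝ) (φ : Zd d → ℝ), 0 < cellSq M φ ∧ cellForm M w φ = E * cellSq M φ ∧
      ∀ u, E * cellSq M u ≤ cellForm M w u := by
  set K : Set (Zd d → ℝ) := {u | (∀ n, n ∉ dbox (fun _ => 1) M → u n = 0) ∧ cellSq M u = 1}
    with hK
  have hKc : IsCompact K := by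
    refine IsCompact.of_isClosed_subset
      (isCompact_univ_pi fun _ : Zd d => isCompact_Icc (a := (-1 : ℝ)) (b := 1)) ?_ ?_
    · refine IsClosed.inter ?_ (isClosed_eq (by unfold cellSq; fun_prop) continuous_const)
      have : {u : Zd d → ℝ | ∀ n, n ∉ dbox (fun _ => 1) M → u n = 0}
          = ⋂ n, ⋂ (_ : n ∉ dbox (fun _ => 1) M), {u | u n = 0} := by
        ext u; simp
      change IsClosed {u : Zd d → ℝ | ∀ n, n ∉ dbox (fun _ => 1) M → u n = 0}
      rw [this]
      exact isClosed_iInter fun n => isClosed_iInter fun _ =>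
        isClosed_eq (continuous_apply n) continuous_const
    · rintro u ⟨h0, h1⟩ n -
      by_cases hn : n ∈ dbox (fun _ => 1) M
      · have : u n ^ 2 ≤ 1 := by
          rw [← h1]
          exact Finset.single_le_sum (f := fun n => u n ^ 2) (fun _ _ => sq_nonneg _) hn
        exact abs_le.1 (by rwa [← sq_le_one_iff_abs_le_one])
      · rw [h0 n hn]; norm_num
  have hne : K.Nonempty := by
    have h1 : (fun _ => 1 : Zd d) ∈ dbox (fun _ => 1) M := mem_dbox.2 fun i => ⟨le_rfl, hM i⟩
    refine ⟨Pi.single (fun _ => 1) 1, fun n hn => ?_, ?_⟩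
    · rw [Pi.single_apply, if_neg]
      rintro rfl
      exact hn h1
    · rw [cellSq, Finset.sum_eq_single_of_mem _ h1]
      · simp
      · intro n _ hn; simp [hn]
  obtain ⟨φ, ⟨hφ0, hφ1⟩, hmin⟩ := hKc.exists_isMinOn hne (continuous_cellForm M w).continuousOn
  refine ⟨cellForm M w φ, φ, by rw [hφ1]; norm_num, by rw [hφ1, mul_one], fun u => ?_⟩
  rcases (cellSq_nonneg M u).eq_or_lt with h0 | h0
  · rw [← h0, mul_zero]
    have hz : ∀ n ∈ dbox (fun _ => 1) M, u n = 0 := by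
      intro n hn
      have := (Finset.sum_eq_zero_iff_of_nonneg fun n _ => sq_nonneg (u n)).1 h0.symm n hn
      exact pow_eq_zero_iff two_ne_zero |>.1 this
    rw [cellForm_congr (fun _ _ => rfl) (u' := fun n => 0 * u n) (fun n hn => by simp [hz n hn]),
      cellForm_smul]
    simp
  · set t : ℝ := (Real.sqrt (cellSq M u))⁻¹ with ht
    have ht2 : t ^ 2 = (cellSq M u)⁻¹ := by rw [ht, inv_pow, Real.sq_sqrt h0.le]
    set v : Zd d → ℝ := fun n => if n ∈ dbox (fun _ => 1) M then t * u n else 0 with hv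
    have hvK : v ∈ K := by
      refine ⟨fun n hn => by simp [hv, hn], ?_⟩
      have : cellSq M v = t ^ 2 * cellSq M u := by
        rw [cellSq, cellSq, Finset.mul_sum]
        refine Finset.sum_congr rfl fun n hn => ?_
        rw [hv]; simp only [if_pos hn]; ring
      rw [this, ht2, inv_mul_cancel₀ h0.ne']
    have h1 : cellForm M w φ ≤ cellForm M w v := hmin hvK
    rw [cellForm_congr (fun _ _ => rfl) (u := v) (u' := fun n => t * u n)
      (fun n hn => by simp only [hv, if_pos hn]), cellForm_smul, ht2] at h1
    calc cellForm M w φ * cellSq M u ≤ ((cellSq M u)⁻¹ * cellForm M w u) * cellSq M u := by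
          gcongr
      _ = cellForm M w u := by field_simp

theorem sum_cell_shift (M : Zd d) (i : Fin d) (f : Zd d → ℝ) :
    ∑ n ∈ dbox (fun _ => 1) M with 1 < n i, f (n - coordVec i)
      = ∑ n ∈ dbox (fun _ => 1) M with n i < M i, f n := by
  have h1 := coordVec_self i
  refine Finset.sum_nbij' (fun n => n - coordVec i) (fun n => n + coordVec i) ?_ ?_ ?_ ?_ ?_
  · intro n hn
    rw [Finset.mem_filter] at hn ⊢
    refine ⟨sub_coordVec_mem_cell hn.1 hn.2, ?_⟩
    have := mem_dbox.1 hn.1 i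
    simp only [Pi.sub_apply]; omega
  · intro n hn
    rw [Finset.mem_filter] at hn ⊢
    refine ⟨add_coordVec_mem_cell hn.1 hn.2, ?_⟩
    have := mem_dbox.1 hn.1 i
    simp only [Pi.add_apply]; omega
  · intro n _; simp
  · intro n _; simp
  · intro n _; rfl

/-- Shift down by one in direction `i`, fixing the bottom slice of `∏ [1, M i]`. -/
def shiftDown (i : Fin d) (n : Zd d) : Zd d := if 1 < n i then n - coordVec i else n

/-- Shift up by one in direction `i`, fixing the top slice of `∏ [1, M i]`. -/
def shiftUp (M : Zd d) (i : Fin d) (n : Zd d) : Zd d := if n i < M i then n + coordVec i else n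

theorem sum_shiftDown_add_sum_shiftUp (M : Zd d) (i : Fin d) (f : Zd d → ℝ) :
    ∑ n ∈ dbox (fun _ => 1) M, f (shiftDown i n) + ∑ n ∈ dbox (fun _ => 1) M, f (shiftUp M i n)
      = 2 * ∑ n ∈ dbox (fun _ => 1) M, f n := by
  have h1 := sum_cell_shift M i f
  have h2 := sum_cell_shift M i fun n => f (n + coordVec i)
  simp only [sub_add_cancel] at h2
  have h3 : ∑ n ∈ dbox (fun _ => 1) M, f (shiftDown i n)
      = ∑ n ∈ dbox (fun _ => 1) M with 1 < n i, f (n - coordVec i)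
        + ∑ n ∈ dbox (fun _ => 1) M with ¬ 1 < n i, f n := by
    rw [← Finset.sum_filter_add_sum_filter_not _ (fun n : Zd d => 1 < n i)]
    congr 1 <;> refine Finset.sum_congr rfl fun n hn => ?_ <;>
      simp [shiftDown, (Finset.mem_filter.1 hn).2]
  have h4 : ∑ n ∈ dbox (fun _ => 1) M, f (shiftUp M i n)
      = ∑ n ∈ dbox (fun _ => 1) M with n i < M i, f (n + coordVec i)
        + ∑ n ∈ dbox (fun _ => 1) M with ¬ n i < M i, f n := by
    rw [← Finset.sum_filter_add_sum_filter_not _ (fun n : Zd d => n i < M i)]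
    congr 1 <;> refine Finset.sum_congr rfl fun n hn => ?_ <;>
      simp [shiftUp, (Finset.mem_filter.1 hn).2]
  have h5 := Finset.sum_filter_add_sum_filter_not (dbox (fun _ => 1) M) (fun n => 1 < n i) f
  have h6 := Finset.sum_filter_add_sum_filter_not (dbox (fun _ => 1) M) (fun n => n i < M i) f
  rw [h3, h4]
  linarith

/-- Reflect the coordinates in `T` of the box `∏ [1, M i]`. -/
def reflect (M : Zd d) (T : Finset (Fin d)) (n : Zd d) : Zd d :=
  fun i => if i ∈ T then M i + 1 - n i else n i

theorem reflect_reflect (M : Zd d) (T : Finset (Fin d)) (n : Zd d) :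
    reflect M T (reflect M T n) = n := by
  funext i
  simp only [reflect]
  split_ifs <;> ring

theorem reflect_mem {M : Zd d} (T : Finset (Fin d)) {n : Zd d} (hn : n ∈ dbox (fun _ => 1) M) :
    reflect M T n ∈ dbox (fun _ => 1) M := by
  rw [mem_dbox] at hn ⊢
  intro i
  have := hn i
  simp only [reflect]
  split_ifs <;> omega

theorem sum_reflect (M : Zd d) (T : Finset (Fin d)) (f : Zd d → ℝ) :
    ∑ n ∈ dbox (fun _ => 1) M, f (reflect M T n) = ∑ n ∈ dbox (fun _ => 1) M, f n :=
  Finset.sum_nbij' (reflect M T) (reflect M T) (fun _ => reflect_mem T) (fun _ => reflect_mem T)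
    (fun _ _ => reflect_reflect M T _) (fun _ _ => reflect_reflect M T _) fun _ _ => rfl

theorem cellForm_reflect (M : Zd d) (T : Finset (Fin d)) (w u : Zd d → ℝ) :
    cellForm M (fun n => w (reflect M T n)) (fun n => u (reflect M T n)) = cellForm M w u := by
  simp only [cellForm, cellDens, Finset.sum_add_distrib]
  rw [sum_reflect M T fun n => w n * u n ^ 2]
  congr 1
  rw [Finset.sum_comm, Finset.sum_comm (s := dbox (fun _ => 1) M)]
  refine Finset.sum_congr rfl fun i _ => ?_
  by_cases hi : i ∈ T
  · have h1 : ∀ n, reflect M T (n + coordVec i) = reflect M T n - coordVec i := by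
      intro n
      funext j
      have := coordVec_apply i j
      simp only [reflect, Pi.add_apply, Pi.sub_apply]
      split_ifs at this ⊢ <;> simp_all
      omega
    have h2 : ∀ n : Zd d, (if n i < M i then
        (u (reflect M T (n + coordVec i)) - u (reflect M T n)) ^ 2 else 0)
        = (fun m : Zd d => if 1 < m i then (u (m - coordVec i) - u m) ^ 2 else 0)
          (reflect M T n) := by
      intro n
      have : 1 < reflect M T n i ↔ n i < M i := by
        simp only [reflect, if_pos hi]; omega
      simp only [this, h1]
    refine ((Finset.sum_congr rfl fun n _ => h2 n).trans (sum_reflect M T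
      fun m => if 1 < m i then (u (m - coordVec i) - u m) ^ 2 else 0)).trans ?_
    rw [← Finset.sum_filter, ← Finset.sum_filter, ← sum_cell_shift]
    refine Finset.sum_congr rfl fun n _ => ?_
    rw [sub_add_cancel]
    ring
  · have h1 : ∀ n, reflect M T (n + coordVec i) = reflect M T n + coordVec i := by
      intro n
      funext j
      have := coordVec_apply i j
      simp only [reflect, Pi.add_apply]
      split_ifs at this ⊢ <;> simp_all
    have h2 : ∀ n : Zd d, (if n i < M i then
        (u (reflect M T (n + coordVec i)) - u (reflect M T n)) ^ 2 else 0)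
        = (fun m : Zd d => if m i < M i then (u (m + coordVec i) - u m) ^ 2 else 0)
          (reflect M T n) := by
      intro n
      have : reflect M T n i = n i := by simp only [reflect, if_neg hi]
      simp only [this, h1]
    exact (Finset.sum_congr rfl fun n _ => h2 n).trans (sum_reflect M T
      fun m => if m i < M i then (u (m + coordVec i) - u m) ^ 2 else 0)

end Cell

section Corner

variable {d : ℕ}

theorem cellDens_shiftDown_le {M : Zd d} {i : Fin d} (hMi : 1 < M i) {w w' u : Zd d → ℝ}
    {n : Zd d} (hn : n ∈ dbox (fun _ => 1) M) (hw : w' n = w (shiftDown i n)) :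
    cellDens M w' (fun m => u (shiftDown i m)) n
        + (if 1 < n i then 0 else (u (n + coordVec i) - u n) ^ 2)
      ≤ cellDens M w u (shiftDown i n) := by
  have hbox := mem_dbox.1 hn
  have h1 := coordVec_self i
  rw [cellDens, cellDens, hw, add_right_comm]
  gcongr ?_ + _
  have hX : (if 1 < n i then 0 else (u (n + coordVec i) - u n) ^ 2)
      = ∑ j, if j = i then (if 1 < n i then 0 else (u (n + coordVec j) - u n) ^ 2) else 0 := by
    simp
  rw [hX, ← Finset.sum_add_distrib]
  refine Finset.sum_le_sum fun j _ => ?_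
  by_cases hj : j = i
  · subst hj
    by_cases h : 1 < n j
    · have e1 : shiftDown j n = n - coordVec j := if_pos h
      have e2 : shiftDown j (n + coordVec j) = n := by
        rw [shiftDown, if_pos, add_sub_cancel_right]
        simp only [Pi.add_apply]; omega
      have e3 : (n - coordVec j) j < M j := by
        have := (hbox j).2
        simp only [Pi.sub_apply]; omega
      rw [e1, e2, if_pos e3, sub_add_cancel, if_pos rfl, if_pos h, add_zero]
      split_ifs
      · exact le_rfl
      · positivity
    · have e1 : shiftDown j n = n := if_neg h
      have e2 : shiftDown j (n + coordVec j) = n := by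
        rw [shiftDown, if_pos, add_sub_cancel_right]
        have := (hbox j).1
        simp only [Pi.add_apply]; omega
      rw [e1, e2]
      have e3 : n j < M j := by omega
      simp [e3, h]
  · have h2 := coordVec_of_ne (Ne.symm hj)
    have h3 := coordVec_of_ne hj
    have e0 : shiftDown i n j = n j := by
      rw [shiftDown]; split_ifs <;> simp [h3]
    have e1 : shiftDown i (n + coordVec j) = shiftDown i n + coordVec j := by
      simp only [shiftDown, Pi.add_apply, h2, add_zero]
      split_ifs
      · abel
      · rfl
    rw [e0, e1]
    simp [hj]

theorem cellDens_shiftUp_le {M : Zd d} {i : Fin d} {w w' u : Zd d → ℝ}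
    {n : Zd d} (hn : n ∈ dbox (fun _ => 1) M) (hw : w' n = w (shiftUp M i n)) :
    cellDens M w' (fun m => u (shiftUp M i m)) n ≤ cellDens M w u (shiftUp M i n) := by
  have hbox := mem_dbox.1 hn
  have h1 := coordVec_self i
  rw [cellDens, cellDens, hw]
  gcongr with j _
  by_cases hj : j = i
  · subst hj
    by_cases h : n j < M j
    · have e1 : shiftUp M j n = n + coordVec j := if_pos h
      rw [if_pos h, e1]
      by_cases h' : n j + 1 < M j
      · rw [if_pos (by simp only [Pi.add_apply]; omega), shiftUp,
          if_pos (by simp only [Pi.add_apply]; omega)]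
      · rw [if_neg (by simp only [Pi.add_apply]; omega), shiftUp,
          if_neg (by simp only [Pi.add_apply]; omega)]
        simp
    · rw [if_neg h]
      split_ifs <;> positivity
  · have h2 := coordVec_of_ne (Ne.symm hj)
    have h3 := coordVec_of_ne hj
    have e0 : shiftUp M i n j = n j := by
      rw [shiftUp]; split_ifs <;> simp [h3]
    have e1 : shiftUp M i (n + coordVec j) = shiftUp M i n + coordVec j := by
      simp only [shiftUp, Pi.add_apply, h2, add_zero]
      split_ifs
      · abel
      · rfl
    rw [e0, e1]

theorem eq_zero_of_apply_lt {b : Zd d} {q : Zd d → ℝ}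
    (hsupp : ∀ n, n ∉ dbox (fun _ => 1) b → q n = 0) {n : Zd d} (i : Fin d)
    (h : n i < 1 ∨ b i < n i) : q n = 0 := by
  refine hsupp n fun hn => ?_
  have := mem_dbox.1 hn i
  omega

/-- If a ground state energy is minimal at a non-extremal position of the single-site potential,
it is still minimal after moving the single-site potential by one step. -/
theorem minimal_energy_step {M b : Zd d} {q : Zd d → ℝ} (hb : ∀ i, 1 ≤ b i)
    (hsupp : ∀ n, n ∉ dbox (fun _ => 1) b → q n = 0) {E : ℝ} {a : Zd d} {i : Fin d}
    (ha0 : 0 < a i) (ha1 : a i < M i - b i)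
    (hup : ∀ u, E * cellSq M u ≤ cellForm M (fun n => q (n - (a + coordVec i))) u)
    (hdown : ∀ u, E * cellSq M u ≤ cellForm M (fun n => q (n - (a - coordVec i))) u)
    (hex : ∃ u, 0 < cellSq M u ∧ cellForm M (fun n => q (n - a)) u ≤ E * cellSq M u) :
    ∃ u, 0 < cellSq M u ∧ cellForm M (fun n => q (n - (a - coordVec i))) u ≤ E * cellSq M u := by
  obtain ⟨u, hu0, hu⟩ := hex
  have h1 := coordVec_self i
  have hbi := hb i
  set X := ∑ n ∈ dbox (fun _ => 1) M, (if 1 < n i then 0 else (u (n + coordVec i) - u n) ^ 2)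
    with hX
  have hXnn : ∀ n ∈ dbox (fun _ => 1) M,
      0 ≤ (if 1 < n i then 0 else (u (n + coordVec i) - u n) ^ 2) := fun n _ => by
    split_ifs <;> positivity
  have hD : cellForm M (fun n => q (n - (a + coordVec i))) (fun m => u (shiftDown i m)) + X
      ≤ ∑ n ∈ dbox (fun _ => 1) M, cellDens M (fun n => q (n - a)) u (shiftDown i n) := by
    rw [cellForm, hX, ← Finset.sum_add_distrib]
    refine Finset.sum_le_sum fun n hn => cellDens_shiftDown_le (by omega) hn ?_
    have hni := mem_dbox.1 hn i
    rw [shiftDown]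
    split_ifs with h
    · congr 1; abel
    · rw [eq_zero_of_apply_lt hsupp i (by simp only [Pi.sub_apply, Pi.add_apply]; omega),
        eq_zero_of_apply_lt hsupp i (by simp only [Pi.sub_apply]; omega)]
  have hU : cellForm M (fun n => q (n - (a - coordVec i))) (fun m => u (shiftUp M i m))
      ≤ ∑ n ∈ dbox (fun _ => 1) M, cellDens M (fun n => q (n - a)) u (shiftUp M i n) := by
    rw [cellForm]
    refine Finset.sum_le_sum fun n hn => cellDens_shiftUp_le hn ?_
    have hni := mem_dbox.1 hn i
    rw [shiftUp]
    split_ifs with h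
    · congr 1; abel
    · rw [eq_zero_of_apply_lt hsupp i (by simp only [Pi.sub_apply]; omega),
        eq_zero_of_apply_lt hsupp i (by simp only [Pi.sub_apply]; omega)]
  have hsum := sum_shiftDown_add_sum_shiftUp M i (cellDens M (fun n => q (n - a)) u)
  have hsq : cellSq M (fun m => u (shiftDown i m)) + cellSq M (fun m => u (shiftUp M i m))
      = 2 * cellSq M u := sum_shiftDown_add_sum_shiftUp M i fun n => u n ^ 2
  have hup' := hup fun m => u (shiftDown i m)
  have hdown' := hdown fun m => u (shiftUp M i m)
  rw [cellForm] at hu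
  have hkey : X + cellForm M (fun n => q (n - (a - coordVec i))) (fun m => u (shiftUp M i m))
      ≤ E * cellSq M fun m => u (shiftUp M i m) := by
    linear_combination hD + hU + hsum + 2 * hu + hup' - E * hsq
  have hX0 : 0 ≤ X := Finset.sum_nonneg hXnn
  refine ⟨fun m => u (shiftUp M i m), ?_, by linarith⟩
  refine (cellSq_nonneg M _).lt_of_ne' fun hzero => hu0.ne' ?_
  have hXz : X = 0 := by
    rw [hzero] at hkey hdown'
    linarith
  rw [hX, Finset.sum_eq_zero_iff_of_nonneg hXnn] at hXz
  rw [cellSq, Finset.sum_eq_zero_iff_of_nonneg fun _ _ => sq_nonneg _] at hzero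
  refine Finset.sum_eq_zero fun n hn => ?_
  have hni := mem_dbox.1 hn i
  by_cases h : 1 < n i
  · have := hzero _ (sub_coordVec_mem_cell hn h)
    rw [shiftUp, if_pos (by simp only [Pi.sub_apply]; omega), sub_add_cancel] at this
    exact this
  · have e1 := hzero n hn
    have e2 := hXz n hn
    rw [shiftUp, if_pos (by omega), pow_eq_zero_iff two_ne_zero] at e1
    rwa [if_neg h, e1, zero_sub, neg_sq] at e2

theorem eq_of_reflected {b : Zd d} {q : Zd d → ℝ}
    (hH1 : ∀ (x : Zd d) (i : Fin d), q x = q (Function.update x i (b i - x i + 1)))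
    (T : Finset (Fin d)) (x : Zd d) :
    q (fun i => if i ∈ T then b i - x i + 1 else x i) = q x := by
  induction T using Finset.induction_on with
  | empty => simp
  | insert j T hj ih =>
    rw [← ih, hH1 (fun i => if i ∈ T then b i - x i + 1 else x i) j]
    congr 1
    funext i
    by_cases h : i = j
    · subst h; simp [hj]
    · simp [h]

theorem exists_at_zero_of_exists {M b : Zd d} {q : Zd d → ℝ} (hb : ∀ i, 1 ≤ b i)
    (hsupp : ∀ n, n ∉ dbox (fun _ => 1) b → q n = 0)
    (hH1 : ∀ (x : Zd d) (i : Fin d), q x = q (Function.update x i (b i - x i + 1)))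
    {E : ℝ} (hmin : ∀ a : Zd d, (∀ i, 0 ≤ a i ∧ a i ≤ M i - b i) →
      ∀ u, E * cellSq M u ≤ cellForm M (fun n => q (n - a)) u)
    (N : ℕ) : ∀ a : Zd d, (∀ i, 0 ≤ a i ∧ a i ≤ M i - b i) → ∑ i, a i ≤ N →
      (∃ u, 0 < cellSq M u ∧ cellForm M (fun n => q (n - a)) u ≤ E * cellSq M u) →
      ∃ u, 0 < cellSq M u ∧ cellForm M (fun n => q (n - 0)) u ≤ E * cellSq M u := by
  induction N with
  | zero =>
    intro a ha hsum hex
    have h0 : a = 0 := by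
      have := (Finset.sum_eq_zero_iff_of_nonneg fun i _ => (ha i).1).1
        (le_antisymm (by simpa using hsum) (Finset.sum_nonneg fun i _ => (ha i).1))
      funext i
      exact this i (Finset.mem_univ i)
    rwa [h0] at hex
  | succ N ih =>
    intro a ha hsum hex
    by_cases h0 : a = 0
    · rwa [h0] at hex
    obtain ⟨i, hi⟩ := Function.ne_iff.1 h0
    have hai := ha i
    have hpos : 0 < a i := lt_of_le_of_ne hai.1 (Ne.symm hi)
    have hMb : ∀ j, 0 ≤ M j - b j := fun j => (ha j).1.trans (ha j).2
    have hadm : ∀ c : ℤ, 0 ≤ c → c ≤ M i - b i →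
        ∀ j, 0 ≤ Function.update a i c j ∧ Function.update a i c j ≤ M j - b j := by
      intro c h1 h2 j
      by_cases hj : j = i
      · subst hj; simp [h1, h2]
      · simpa [hj] using ha j
    have hadd : ∀ c : ℤ, a + c • coordVec i = Function.update a i (a i + c) := by
      intro c
      funext j
      have := coordVec_apply i j
      by_cases hj : j = i
      · subst hj; simp_all
      · simp_all
    have hsumlt : ∀ c : ℤ, c < a i → ∑ j, Function.update a i c j ≤ N := by
      intro c hc
      have h1 := Finset.add_sum_erase Finset.univ (fun j => a j) (Finset.mem_univ i)
      have h2 := Finset.add_sum_erase Finset.univ (fun j => Function.update a i c j)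
        (Finset.mem_univ i)
      have h3 : ∑ j ∈ Finset.univ.erase i, Function.update a i c j
          = ∑ j ∈ Finset.univ.erase i, a j :=
        Finset.sum_congr rfl fun j hj => Function.update_of_ne (Finset.ne_of_mem_erase hj) c a
      simp only [Function.update_self, h3] at h2
      push_cast at hsum
      linarith
    rcases hai.2.lt_or_eq with hlt | heq
    · have e1 : a + coordVec i = Function.update a i (a i + 1) := by simpa using hadd 1
      have e2 : a - coordVec i = Function.update a i (a i - 1) := by
        simpa [sub_eq_add_neg] using hadd (-1)
      refine ih (a - coordVec i) (by rw [e2]; exact hadm _ (by omega) (by omega))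
        (by rw [e2]; exact hsumlt _ (by omega)) ?_
      exact minimal_energy_step hb hsupp hpos hlt
        (hmin _ (by rw [e1]; exact hadm _ (by omega) (by omega)))
        (hmin _ (by rw [e2]; exact hadm _ (by omega) (by omega))) hex
    · refine ih (Function.update a i 0) (hadm _ le_rfl (hMb i)) (hsumlt _ hpos) ?_
      obtain ⟨u, hu0, hu⟩ := hex
      refine ⟨fun n => u (reflect M {i} n), ?_, ?_⟩
      · have : cellSq M (fun n => u (reflect M {i} n)) = cellSq M u :=
          sum_reflect M {i} fun n => u n ^ 2
        rwa [this]
      · have e1 : cellSq M (fun n => u (reflect M {i} n)) = cellSq M u :=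
          sum_reflect M {i} fun n => u n ^ 2
        rw [e1, ← cellForm_reflect M {i} (fun n => q (n - a)) u] at *
        refine le_trans (le_of_eq (cellForm_congr (fun n _ => ?_) fun _ _ => rfl)) hu
        rw [← eq_of_reflected hH1 {i} (n - Function.update a i 0)]
        congr 1
        funext j
        by_cases hj : j = i
        · subst hj; simp [reflect]; omega
        · simp [reflect, hj]

/-- Among all positions of the single-site potential, the Neumann ground state energy is minimal
at the corner `0`. -/
theorem cellForm_nonneg_of_corner {M b : Zd d} {q : Zd d → ℝ} (hb : ∀ i, 1 ≤ b i)
    (hbM : ∀ i, b i ≤ M i)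
    (hsupp : ∀ n, n ∉ dbox (fun _ => 1) b → q n = 0)
    (hH1 : ∀ (x : Zd d) (i : Fin d), q x = q (Function.update x i (b i - x i + 1)))
    {c : ℝ} (h0 : ∀ u, c * cellSq M u ≤ cellForm M q u)
    {a : Zd d} (ha : ∀ i, 0 ≤ a i ∧ a i ≤ M i - b i) (u : Zd d → ℝ) :
    c * cellSq M u ≤ cellForm M (fun n => q (n - a)) u := by
  choose E φ hφ0 hφ hE using fun a : Zd d =>
    exists_cell_ground_state (fun i => (hb i).trans (hbM i)) fun n => q (n - a)
  obtain ⟨a₀, ha₀, hmin⟩ := Finset.exists_min_image (dbox (fun _ => 0) fun i => M i - b i) E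
    ⟨0, mem_dbox.2 fun i => ⟨le_rfl, sub_nonneg.2 (hbM i)⟩⟩
  rw [mem_dbox] at ha₀
  have hmin' : ∀ a : Zd d, (∀ i, 0 ≤ a i ∧ a i ≤ M i - b i) →
      ∀ u, E a₀ * cellSq M u ≤ cellForm M (fun n => q (n - a)) u := fun a ha u =>
    (mul_le_mul_of_nonneg_right (hmin a (mem_dbox.2 ha)) (cellSq_nonneg M u)).trans (hE a u)
  obtain ⟨v, hv0, hv⟩ := exists_at_zero_of_exists hb hsupp hH1 hmin' (∑ i, a₀ i).toNat a₀ ha₀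
    (Int.self_le_toNat _) ⟨φ a₀, hφ0 a₀, (hφ a₀).le⟩
  simp only [sub_zero] at hv
  have hc : c ≤ E a₀ := le_of_mul_le_mul_right ((h0 v).trans hv) hv0
  exact (mul_le_mul_of_nonneg_right hc (cellSq_nonneg M u)).trans (hmin' a ha u)

end Corner

section Cells

variable {d : ℕ}

/-- The lattice point `kM`. -/
def cellShift (M k : Zd d) : Zd d := fun i => k i * M i

/-- The index `k` of the cell `kM + ∏ [1, M i]` containing `n`. -/
def cellIdx (M n : Zd d) : Zd d := fun i => (n i - 1) / M i

theorem cellIdx_add_cellShift {M m : Zd d} (hm : m ∈ dbox (fun _ => 1) M) (k : Zd d) :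
    cellIdx M (m + cellShift M k) = k := by
  funext i
  have := mem_dbox.1 hm i
  have e : m i + k i * M i - 1 = m i - 1 + k i * M i := by ring
  simp only [cellIdx, cellShift, Pi.add_apply]
  rw [e, Int.add_mul_ediv_right _ _ (by omega), Int.ediv_eq_zero_of_lt (by omega) (by omega),
    zero_add]

theorem sub_cellShift_mem {M : Zd d} (hM : ∀ i, 1 ≤ M i) (n : Zd d) :
    n - cellShift M (cellIdx M n) ∈ dbox (fun _ => 1) M := by
  rw [mem_dbox]
  intro i
  have h0 := hM i
  have h1 := Int.emod_add_ediv_mul (n i - 1) (M i)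
  have h2 := Int.emod_nonneg (n i - 1) (by omega : M i ≠ 0)
  have h3 := Int.emod_lt_of_pos (n i - 1) (by omega : 0 < M i)
  simp only [cellIdx, cellShift, Pi.sub_apply]
  constructor <;> linarith

theorem exists_eq_add_cellShift {M : Zd d} (hM : ∀ i, 1 ≤ M i) (n : Zd d) :
    ∃ m ∈ dbox (fun _ => 1) M, m + cellShift M (cellIdx M n) = n :=
  ⟨_, sub_cellShift_mem hM n, sub_add_cancel _ _⟩

theorem tsum_eq_sum_cells {M : Zd d} (hM : ∀ i, 1 ≤ M i) {f : Zd d → ℝ} (K : Finset (Zd d))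
    (hK : ∀ n, cellIdx M n ∉ K → f n = 0) :
    ∑' n, f n = ∑ k ∈ K, ∑ m ∈ dbox (fun _ => 1) M, f (m + cellShift M k) := by
  rw [← Finset.sum_product' K _ fun k m => f (m + cellShift M k),
    ← Finset.sum_image (s := K ×ˢ dbox (fun _ => 1) M)
      (g := fun p : Zd d × Zd d => p.2 + cellShift M p.1) (f := f)]
  · refine tsum_eq_sum fun n hn => hK n fun hk => hn ?_
    exact Finset.mem_image.2 ⟨(cellIdx M n, n - cellShift M (cellIdx M n)),
      Finset.mem_product.2 ⟨hk, sub_cellShift_mem hM n⟩, sub_add_cancel _ _⟩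
  · rintro ⟨k, m⟩ h ⟨k', m'⟩ h' heq
    simp only [Finset.coe_product, Set.mem_prod, Finset.mem_coe] at h h' heq
    have hk : k = k' := by
      rw [← cellIdx_add_cellShift h.2 k, heq, cellIdx_add_cellShift h'.2]
    subst hk
    simpa using heq

theorem update_mem_cell {M m : Zd d} (hm : m ∈ dbox (fun _ => 1) M) (i : Fin d) :
    Function.update m i 1 ∈ dbox (fun _ => 1) M := by
  rw [mem_dbox] at hm ⊢
  intro j
  have hj := hm j
  by_cases h : j = i
  · subst h; simp; omega
  · simpa [h] using hj

theorem add_cellShift_add_coordVec {M m k : Zd d} {i : Fin d} (hi : m i = M i) :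
    m + cellShift M k + coordVec i
      = Function.update m i 1 + cellShift M (k + coordVec i) := by
  funext j
  have := coordVec_apply i j
  by_cases h : j = i
  · subst h
    simp only [cellShift, Pi.add_apply, Function.update_self, this, if_true, hi]
    ring
  · simp only [cellShift, Pi.add_apply, Function.update_of_ne h, this, if_neg h]
    ring

theorem Vpot_add_cellShift {M b : Zd d} {q : Zd d → ℝ}
    (hsupp : ∀ n, n ∉ dbox (fun _ => 1) b → q n = 0) {ω : Zd d → Zd d} (hω : adm M b ω)
    {m : Zd d} (hm : m ∈ dbox (fun _ => 1) M) (k : Zd d) :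
    Vpot M q ω (m + cellShift M k) = q (m - ω k) := by
  rw [Vpot, tsum_eq_single k]
  · congr 1
    funext i
    simp [cellShift]
  · intro k' hk'
    obtain ⟨i, hi⟩ := Function.ne_iff.1 hk'
    have h1 := hω k' i
    have h2 := mem_dbox.1 hm i
    refine eq_zero_of_apply_lt hsupp i ?_
    simp only [cellShift, Pi.add_apply]
    rcases lt_or_gt_of_ne hi with h | h
    · right
      nlinarith [mul_le_mul_of_nonneg_right (show 1 ≤ k i - k' i by omega)
        (show 0 ≤ M i by omega)]
    · left
      nlinarith [mul_le_mul_of_nonneg_right (show 1 ≤ k' i - k i by omega)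
        (show 0 ≤ M i by omega)]

theorem Vpot_neg (M : Zd d) (q : Zd d → ℝ) (ω : Zd d → Zd d) (n : Zd d) :
    Vpot M (fun n => -q n) ω n = -Vpot M q ω n := tsum_neg

theorem adm_ωstar {M b : Zd d} (hbM : ∀ i, b i ≤ M i) : adm M b (ωstar M b) := by
  intro k i
  have := hbM i
  simp only [ωstar]
  split_ifs <;> omega

theorem gradDens_support_finite {u : Zd d → ℝ} (hu : u.support.Finite) (V : Zd d → ℝ) :
    (gradDens V u).support.Finite := by
  refine (hu.union (Set.finite_iUnion fun i => support_shift_finite hu (coordVec i))).subset ?_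
  intro n hn
  by_contra h
  simp only [Set.mem_union, Set.mem_iUnion, Function.mem_support, not_or, not_exists,
    not_not] at h
  exact hn (by simp [gradDens, h.1, h.2])

/-- Neumann bracketing: if the Neumann form of the single-site potential in the corner position
is at least `c`, then so is the form of every displacement model. -/
theorem formNonneg_of_cellForm {M b : Zd d} {q : Zd d → ℝ} (hb : ∀ i, 1 ≤ b i)
    (hbM : ∀ i, b i ≤ M i) (hsupp : ∀ n, n ∉ dbox (fun _ => 1) b → q n = 0)
    (hH1 : ∀ (x : Zd d) (i : Fin d), q x = q (Function.update x i (b i - x i + 1)))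
    {c : ℝ} (h0 : ∀ u, c * cellSq M u ≤ cellForm M q u) {ω : Zd d → Zd d} (hω : adm M b ω) :
    FormNonneg fun n => Vpot M q ω n - c := by
  intro u hu
  have hM : ∀ i, 1 ≤ M i := fun i => (hb i).trans (hbM i)
  set f := gradDens (fun n => Vpot M q ω n - c) u with hf
  rw [tsum_eq_sum_cells hM ((gradDens_support_finite hu _).toFinset.image (cellIdx M))]
  · refine Finset.sum_nonneg fun k _ => ?_
    have h1 := cellForm_nonneg_of_corner hb hbM hsupp hH1 h0 (hω k)
      (fun m => u (m + cellShift M k))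
    rw [← sub_nonneg, ← cellForm_sub_const] at h1
    refine h1.trans (Finset.sum_le_sum fun m hm => ?_)
    rw [cellDens, hf, gradDens, Vpot_add_cellShift hsupp hω hm]
    gcongr with i _
    split_ifs
    · rw [add_right_comm]
    · positivity
  · intro n hn
    by_contra h
    exact hn (Finset.mem_image_of_mem _ (Set.Finite.mem_toFinset _ |>.2 h))

end Cells

section PeriodicTrial

variable {d : ℕ}

/-- The coordinates in which `k` is odd. -/
def oddCoords (k : Zd d) : Finset (Fin d) := Finset.univ.filter fun i => ¬ Even (k i)

/-- The function obtained from `φ` on `∏ [1, M i]` by repeated reflection, restricted to the cells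
with index in `K`. -/
def reflExt (M : Zd d) (K : Finset (Zd d)) (φ : Zd d → ℝ) (n : Zd d) : ℝ :=
  if cellIdx M n ∈ K then
    φ (reflect M (oddCoords (cellIdx M n)) (n - cellShift M (cellIdx M n)))
  else 0

theorem reflExt_add_cellShift {M m : Zd d} (hm : m ∈ dbox (fun _ => 1) M) (k : Zd d)
    (K : Finset (Zd d)) (φ : Zd d → ℝ) :
    reflExt M K φ (m + cellShift M k) = if k ∈ K then φ (reflect M (oddCoords k) m) else 0 := by
  rw [reflExt, cellIdx_add_cellShift hm, add_sub_cancel_right]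

theorem reflExt_support_finite {M : Zd d} (hM : ∀ i, 1 ≤ M i) (K : Finset (Zd d))
    (φ : Zd d → ℝ) : (reflExt M K φ).support.Finite := by
  refine ((K ×ˢ dbox (fun _ => 1) M).image
    fun p : Zd d × Zd d => p.2 + cellShift M p.1).finite_toSet.subset fun n hn => ?_
  refine Finset.mem_coe.2 (Finset.mem_image.2 ⟨(cellIdx M n, n - cellShift M (cellIdx M n)),
    Finset.mem_product.2 ⟨?_, sub_cellShift_mem hM n⟩, sub_add_cancel _ _⟩)
  by_contra h
  exact hn (if_neg h)

theorem reflect_update_of_eq {M m k : Zd d} {i : Fin d} (hi : m i = M i) :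
    reflect M (oddCoords (k + coordVec i)) (Function.update m i 1)
      = reflect M (oddCoords k) m := by
  funext j
  have := coordVec_apply i j
  by_cases h : j = i
  · subst h
    by_cases hk : Even (k j) <;> simp [reflect, oddCoords, this, hi, hk]
  · simp [reflect, oddCoords, this, h]

theorem Vpot_ωstar_add_cellShift {M b : Zd d} {q : Zd d → ℝ} (hbM : ∀ i, b i ≤ M i)
    (hsupp : ∀ n, n ∉ dbox (fun _ => 1) b → q n = 0)
    (hH1 : ∀ (x : Zd d) (i : Fin d), q x = q (Function.update x i (b i - x i + 1)))
    {m : Zd d} (hm : m ∈ dbox (fun _ => 1) M) (k : Zd d) :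
    Vpot M q (ωstar M b) (m + cellShift M k) = q (reflect M (oddCoords k) m) := by
  rw [Vpot_add_cellShift hsupp (adm_ωstar hbM) hm, ← eq_of_reflected hH1 (oddCoords k)]
  congr 1
  funext i
  simp only [reflect, oddCoords, ωstar, Pi.sub_apply, Finset.mem_filter, Finset.mem_univ, true_and]
  split_ifs <;> ring

theorem gradDens_reflExt_eq_zero {M : Zd d} {K : Finset (Zd d)} {φ V : Zd d → ℝ} {k m : Zd d}
    (hm : m ∈ dbox (fun _ => 1) M) (hk : k ∉ K) (hk' : ∀ i, k + coordVec i ∉ K) :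
    gradDens V (reflExt M K φ) (m + cellShift M k) = 0 := by
  have h0 := reflExt_add_cellShift hm k K φ
  rw [if_neg hk] at h0
  rw [gradDens, h0]
  have : ∀ i, reflExt M K φ (m + cellShift M k + coordVec i) = 0 := by
    intro i
    rcases (mem_dbox.1 hm i).2.lt_or_eq with hi | hi
    · rw [add_right_comm, reflExt_add_cellShift (add_coordVec_mem_cell hm hi), if_neg hk]
    · rw [add_cellShift_add_coordVec hi, reflExt_add_cellShift (update_mem_cell hm i),
        if_neg (hk' i)]
  simp [this]

theorem gradDens_reflExt_eq {M b : Zd d} {q : Zd d → ℝ} (hbM : ∀ i, b i ≤ M i)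
    (hsupp : ∀ n, n ∉ dbox (fun _ => 1) b → q n = 0)
    (hH1 : ∀ (x : Zd d) (i : Fin d), q x = q (Function.update x i (b i - x i + 1)))
    (c : ℝ) {K : Finset (Zd d)} {φ : Zd d → ℝ} {k m : Zd d}
    (hm : m ∈ dbox (fun _ => 1) M) (hk : k ∈ K) (hk' : ∀ i, k + coordVec i ∈ K) :
    gradDens (fun n => Vpot M q (ωstar M b) n - c) (reflExt M K φ) (m + cellShift M k)
      = cellDens M (fun n => q (reflect M (oddCoords k) n) - c)
        (fun n => φ (reflect M (oddCoords k) n)) m := by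
  rw [gradDens, cellDens, Vpot_ωstar_add_cellShift hbM hsupp hH1 hm, reflExt_add_cellShift hm,
    if_pos hk]
  congr 1
  refine Finset.sum_congr rfl fun i _ => ?_
  rcases (mem_dbox.1 hm i).2.lt_or_eq with hi | hi
  · rw [add_right_comm, reflExt_add_cellShift (add_coordVec_mem_cell hm hi), if_pos hk, if_pos hi]
  · rw [add_cellShift_add_coordVec hi, reflExt_add_cellShift (update_mem_cell hm i),
      if_pos (hk' i), reflect_update_of_eq hi, if_neg (by omega), sub_self, sq, zero_mul]

theorem exists_gradDens_reflExt_le {M b : Zd d} {q : Zd d → ℝ} (hb : ∀ i, 1 ≤ b i)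
    (hbM : ∀ i, b i ≤ M i)
    (hsupp : ∀ n, n ∉ dbox (fun _ => 1) b → q n = 0)
    (hH1 : ∀ (x : Zd d) (i : Fin d), q x = q (Function.update x i (b i - x i + 1)))
    (c : ℝ) (φ : Zd d → ℝ) :
    ∃ C, ∀ (K : Finset (Zd d)) (n : Zd d),
      gradDens (fun n => Vpot M q (ωstar M b) n - c) (reflExt M K φ) n ≤ C := by
  have hM : ∀ i, 1 ≤ M i := fun i => (hb i).trans (hbM i)
  obtain ⟨B, hB⟩ : ∃ B, ∀ K n, |reflExt M K φ n| ≤ B := by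
    refine ⟨∑ m ∈ dbox (fun _ => 1) M, |φ m|, fun K n => ?_⟩
    obtain ⟨m, hm, hn⟩ := exists_eq_add_cellShift hM n
    rw [← hn, reflExt_add_cellShift hm]
    split_ifs
    · exact Finset.single_le_sum (f := fun m => |φ m|) (fun _ _ => abs_nonneg _) (reflect_mem _ hm)
    · simpa using Finset.sum_nonneg fun _ _ => abs_nonneg _
  obtain ⟨W, hW⟩ : ∃ W, ∀ n, |Vpot M q (ωstar M b) n - c| ≤ W := by
    refine ⟨∑ m ∈ dbox (fun _ => 1) M, |q m - c|, fun n => ?_⟩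
    obtain ⟨m, hm, hn⟩ := exists_eq_add_cellShift hM n
    rw [← hn, Vpot_ωstar_add_cellShift hbM hsupp hH1 hm]
    exact Finset.single_le_sum (f := fun m => |q m - c|) (fun _ _ => abs_nonneg _)
      (reflect_mem _ hm)
  refine ⟨∑ _i : Fin d, (2 * B) ^ 2 + W * B ^ 2, fun K n => ?_⟩
  rw [gradDens]
  refine add_le_add (Finset.sum_le_sum fun i _ => ?_) ?_
  · refine sq_le_sq' ?_ ?_
    · linarith [neg_le_of_abs_le (hB K (n + coordVec i)), le_of_abs_le (hB K n)]
    · linarith [le_of_abs_le (hB K (n + coordVec i)), neg_le_of_abs_le (hB K n)]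
  · have h1 : reflExt M K φ n ^ 2 ≤ B ^ 2 :=
      sq_le_sq' (neg_le_of_abs_le (hB K n)) (le_of_abs_le (hB K n))
    exact mul_le_mul (le_of_abs_le (hW n)) h1 (sq_nonneg _) ((abs_nonneg _).trans (hW n))

theorem card_dbox_const (lo : ℤ) (L : ℕ) :
    (dbox (fun _ : Fin d => lo) (fun _ => lo + L - 1)).card = L ^ d := by
  simp [dbox, Fintype.card_piFinset]

/-- The Neumann form of the single-site potential is at least `c` as soon as the form of the model
with displacement configuration `ω*` is. -/
theorem cellForm_of_formNonneg_ωstar {M b : Zd d} {q : Zd d → ℝ} (hb : ∀ i, 1 ≤ b i)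
    (hbM : ∀ i, b i ≤ M i)
    (hsupp : ∀ n, n ∉ dbox (fun _ => 1) b → q n = 0)
    (hH1 : ∀ (x : Zd d) (i : Fin d), q x = q (Function.update x i (b i - x i + 1)))
    {c : ℝ} (h : FormNonneg fun n => Vpot M q (ωstar M b) n - c) (φ : Zd d → ℝ) :
    c * cellSq M φ ≤ cellForm M q φ := by
  have hM : ∀ i, 1 ≤ M i := fun i => (hb i).trans (hbM i)
  obtain ⟨C, hC⟩ := exists_gradDens_reflExt_le hb hbM hsupp hH1 c φ
  rw [← sub_nonneg, ← cellForm_sub_const]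
  set X := cellForm M (fun n => q n - c) φ with hX
  set D : ℝ := ∑ _m ∈ dbox (fun _ => 1) M, C with hD
  have hmain : ∀ L : ℕ, 0 ≤ (L : ℝ) ^ d * X + (((L + 2 : ℕ) : ℝ) ^ d - (L : ℝ) ^ d) * D := by
    intro L
    set K : Finset (Zd d) := dbox (fun _ => 0) (fun _ => L) with hK
    set K₀ : Finset (Zd d) := dbox (fun _ => 0) (fun _ => 0 + (L : ℕ) - 1) with hK₀
    set K₁ : Finset (Zd d) := dbox (fun _ => -1) (fun _ => -1 + (L + 2 : ℕ) - 1) with hK₁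
    have hsub : K₀ ⊆ K₁ := by
      intro k hk
      rw [mem_dbox] at hk ⊢
      intro i
      have := hk i
      push_cast
      omega
    have hcv : ∀ i j : Fin d, 0 ≤ coordVec i j ∧ coordVec i j ≤ 1 := by
      intro i j
      rw [coordVec_apply]; split_ifs <;> simp
    have h1 := h _ (reflExt_support_finite hM K φ)
    rw [tsum_eq_sum_cells hM K₁] at h1
    · refine h1.trans ?_
      rw [← Finset.sum_sdiff hsub, add_comm]
      refine add_le_add ?_ ?_
      · have e : ∀ k ∈ K₀, ∑ m ∈ dbox (fun _ => 1) M, gradDens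
            (fun n => Vpot M q (ωstar M b) n - c) (reflExt M K φ) (m + cellShift M k) = X := by
          intro k hk
          rw [hX, ← cellForm_reflect M (oddCoords k) (fun n => q n - c) φ, cellForm]
          rw [hK₀, mem_dbox] at hk
          refine Finset.sum_congr rfl fun m hm => ?_
          refine gradDens_reflExt_eq hbM hsupp hH1 c hm (mem_dbox.2 fun i => ?_)
            fun j => mem_dbox.2 fun i => ?_
          · have := hk i
            omega
          · have := hk i
            have := hcv j i
            simp only [Pi.add_apply]
            omega
        rw [Finset.sum_congr rfl e, Finset.sum_const, card_dbox_const, nsmul_eq_mul]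
        push_cast
        exact le_rfl
      · calc _ ≤ ∑ _k ∈ K₁ \ K₀, D := Finset.sum_le_sum fun k _ =>
              Finset.sum_le_sum fun m _ => hC K _
          _ = _ := by
            rw [Finset.sum_const, Finset.card_sdiff_of_subset hsub, nsmul_eq_mul,
              Nat.cast_sub (Finset.card_le_card hsub), card_dbox_const, card_dbox_const]
            push_cast
            rfl
    · intro n hn
      obtain ⟨m, hm, hmn⟩ := exists_eq_add_cellShift hM n
      rw [← hmn]
      rw [hK₁, mem_dbox] at hn
      push_cast at hn
      refine gradDens_reflExt_eq_zero hm (fun hk => hn fun i => ?_) fun j hk => hn fun i => ?_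
      · have := mem_dbox.1 hk i
        omega
      · have h2 := mem_dbox.1 hk i
        have := hcv j i
        simp only [Pi.add_apply] at h2
        omega
  have hlim : Filter.Tendsto (fun L : ℕ => X + ((1 + 2 / (L : ℝ)) ^ d - 1) * D)
      Filter.atTop (nhds (X + ((1 + 0) ^ d - 1) * D)) :=
    tendsto_const_nhds.add (((((tendsto_const_div_atTop_nhds_zero_nat 2).const_add
      1).pow d).sub_const 1).mul_const D)
  rw [add_zero, one_pow, sub_self, zero_mul, add_zero] at hlim
  refine ge_of_tendsto hlim ?_
  filter_upwards [Filter.eventually_gt_atTop 0] with L hL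
  have hL' : (0 : ℝ) < L := Nat.cast_pos.2 hL
  refine nonneg_of_mul_nonneg_right (a := (L : ℝ) ^ d) ?_ (pow_pos hL' d)
  have hL2 : ((L + 2 : ℕ) : ℝ) ^ d = (L : ℝ) ^ d * (1 + 2 / (L : ℝ)) ^ d := by
    rw [← mul_pow]
    congr 1
    push_cast
    field_simp
  refine (hmain L).trans_eq ?_
  rw [hL2]
  ring

/-- Among all displacement configurations, `ω*` minimizes the form of the displacement model. -/
theorem formNonneg_of_formNonneg_ωstar {M b : Zd d} {q : Zd d → ℝ} (hb : ∀ i, 1 ≤ b i)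
    (hbM : ∀ i, b i ≤ M i)
    (hsupp : ∀ n, n ∉ dbox (fun _ => 1) b → q n = 0)
    (hH1 : ∀ (x : Zd d) (i : Fin d), q x = q (Function.update x i (b i - x i + 1)))
    {c : ℝ} (h : FormNonneg fun n => Vpot M q (ωstar M b) n - c)
    {ω : Zd d → Zd d} (hω : adm M b ω) : FormNonneg fun n => Vpot M q ω n - c :=
  formNonneg_of_cellForm hb hbM hsupp hH1 (cellForm_of_formNonneg_ωstar hb hbM hsupp hH1 h) hω

/-- A displacement configuration containing translates of every finite piece of `ω*` has form at
most that of `ω*`. -/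
theorem formNonneg_ωstar_of_pattern {M b : Zd d} {q : Zd d → ℝ} (hb : ∀ i, 1 ≤ b i)
    (hbM : ∀ i, b i ≤ M i) (hsupp : ∀ n, n ∉ dbox (fun _ => 1) b → q n = 0)
    {ω : Zd d → Zd d} (hω : adm M b ω)
    (hpat : ∀ s : Finset (Zd d), ∃ k₀ : Zd d, ∀ k ∈ s, ω (k + k₀) = ωstar M b k)
    {c : ℝ} (h : FormNonneg fun n => Vpot M q ω n - c) :
    FormNonneg fun n => Vpot M q (ωstar M b) n - c := by
  intro u hu
  have hM : ∀ i, 1 ≤ M i := fun i => (hb i).trans (hbM i)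
  obtain ⟨k₀, hk₀⟩ := hpat (hu.toFinset.image (cellIdx M))
  refine (h _ (support_shift_finite hu (-cellShift M k₀))).trans_eq ?_
  rw [← (Equiv.addRight (cellShift M k₀)).tsum_eq]
  refine tsum_congr fun n => ?_
  have e1 : n + cellShift M k₀ + -cellShift M k₀ = n := by abel
  have e2 : ∀ i, n + cellShift M k₀ + coordVec i + -cellShift M k₀ = n + coordVec i := by
    intro i; abel
  simp only [gradDens, Equiv.coe_addRight, e1, e2]
  congr 1
  by_cases hn : u n = 0
  · simp [hn]
  · congr 2
    obtain ⟨m, hm, hmn⟩ := exists_eq_add_cellShift hM n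
    have e : cellShift M (cellIdx M n) + cellShift M k₀ = cellShift M (cellIdx M n + k₀) := by
      funext i
      simp only [cellShift, Pi.add_apply]
      ring
    rw [← hmn, Vpot_add_cellShift hsupp (adm_ωstar hbM) hm, add_assoc, e,
      Vpot_add_cellShift hsupp hω hm,
      hk₀ _ (Finset.mem_image_of_mem _ (hu.mem_toFinset.2 hn))]

end PeriodicTrial

section Pattern

variable {d : ℕ}

theorem measurableSet_pattern (s : Finset (Zd d)) (g : Zd d → Zd d) :
    MeasurableSet {ω : Zd d → Zd d | ∀ k ∈ s, ω k = g k} := by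
  have : {ω : Zd d → Zd d | ∀ k ∈ s, ω k = g k} = ⋂ k ∈ s, (fun ω => ω k) ⁻¹' {g k} := by
    ext ω; simp
  rw [this]
  exact s.measurableSet_biInter fun k _ => measurable_pi_apply k (measurableSet_singleton _)

variable {μ : Zd d → ℝ≥0∞} {P : Measure (Zd d → Zd d)}

theorem ae_adm {M b : Zd d}
    (hμsupp : ∀ a : Zd d, ¬ (∀ i, 0 ≤ a i ∧ a i ≤ M i - b i) → μ a = 0)
    (hiid : ∀ (s : Finset (Zd d)) (g : Zd d → Zd d),
      P {ω | ∀ k ∈ s, ω k = g k} = ∏ k ∈ s, μ (g k)) :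
    ∀ᵐ ω ∂P, adm M b ω := by
  have h : ∀ᵐ ω ∂P, ∀ k a : Zd d, ¬ (∀ i, 0 ≤ a i ∧ a i ≤ M i - b i) → ω k ≠ a := by
    refine ae_all_iff.2 fun k => ae_all_iff.2 fun a => ?_
    by_cases ha : ∀ i, 0 ≤ a i ∧ a i ≤ M i - b i
    · exact Filter.Eventually.of_forall fun _ h => absurd ha h
    · have h0 := hiid {k} fun _ => a
      simp only [Finset.mem_singleton, forall_eq, Finset.prod_singleton, hμsupp a ha] at h0
      filter_upwards [measure_eq_zero_iff_ae_notMem.1 h0] with ω hω _ using hω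
  filter_upwards [h] with ω hω k
  by_contra hk
  exact hω k _ hk rfl

theorem ωstar_add_even (M b k : Zd d) {t : ℤ} (ht : Even t) :
    ωstar M b (k + fun _ => t) = ωstar M b k := by
  funext i
  simp [ωstar, Int.even_add, ht]

theorem ae_exists_pattern (hd : 1 ≤ d) {M b : Zd d} [IsProbabilityMeasure P]
    (hH2 : ∀ a : Zd d, (∀ i, a i = 0 ∨ a i = M i - b i) → 0 < μ a)
    (hiid : ∀ (s : Finset (Zd d)) (g : Zd d → Zd d),
      P {ω | ∀ k ∈ s, ω k = g k} = ∏ k ∈ s, μ (g k)) (s : Finset (Zd d)) :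
    ∀ᵐ ω ∂P, ∃ k₀ : Zd d, ∀ k ∈ s, ω (k + k₀) = ωstar M b k := by
  set i₀ : Fin d := ⟨0, hd⟩
  obtain ⟨N, hN⟩ : ∃ N : ℤ, ∀ k ∈ s, |k i₀| ≤ N :=
    ⟨∑ k ∈ s, |k i₀|, fun k hk =>
      Finset.single_le_sum (f := fun k : Zd d => |k i₀|) (fun _ _ => abs_nonneg _) hk⟩
  set t : ℕ → Zd d := fun j _ => j * (2 * (N + 1)) with ht
  have heven : ∀ j k, ωstar M b (k + t j) = ωstar M b k := fun j k =>
    ωstar_add_even M b k ((even_two_mul _).mul_left _)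
  set S : ℕ → Finset (Zd d) := fun j => s.image (· + t j) with hS
  set A : ℕ → Set (Zd d → Zd d) := fun j => {ω | ∀ k ∈ S j, ω k = ωstar M b k} with hA
  have hdisj : Pairwise (Function.onFun Disjoint S) := by
    intro j j' hj
    refine Finset.disjoint_left.2 fun x hx hx' => ?_
    obtain ⟨k, hk, rfl⟩ := Finset.mem_image.1 hx
    obtain ⟨k', hk', he⟩ := Finset.mem_image.1 hx'
    have h1 := abs_le.1 (hN k hk)
    have h2 := abs_le.1 (hN k' hk')
    have h3 : k' i₀ + j' * (2 * (N + 1)) = k i₀ + j * (2 * (N + 1)) := congrFun he i₀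
    rcases lt_or_gt_of_ne hj with h | h
    · have : (j : ℤ) + 1 ≤ j' := by exact_mod_cast h
      nlinarith [mul_le_mul_of_nonneg_right this (show 0 ≤ 2 * (N + 1) by omega)]
    · have : (j' : ℤ) + 1 ≤ j := by exact_mod_cast h
      nlinarith [mul_le_mul_of_nonneg_right this (show 0 ≤ 2 * (N + 1) by omega)]
  have hmeas : ∀ j, MeasurableSet (A j) := fun j => measurableSet_pattern (S j) _
  have hindep : ProbabilityTheory.iIndepSet A P := by
    rw [ProbabilityTheory.iIndepSet_iff_meas_biInter hmeas]
    intro J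
    have h1 : ⋂ j ∈ J, A j = {ω | ∀ k ∈ J.biUnion S, ω k = ωstar M b k} := by
      ext ω
      simp only [hA, Set.mem_iInter, Set.mem_ofPred_eq, Finset.mem_biUnion]
      exact ⟨fun h k ⟨j, hj, hk⟩ => h j hj k hk, fun h j hj k hk => h k ⟨j, hj, hk⟩⟩
    rw [h1, hiid, Finset.prod_biUnion fun j _ j' _ hj => hdisj hj]
    exact Finset.prod_congr rfl fun j _ => (hiid _ _).symm
  have hp : ∀ j, P (A j) = ∏ k ∈ s, μ (ωstar M b k) := by
    intro j
    rw [hiid, hS, Finset.prod_image fun _ _ _ _ h => add_right_cancel h]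
    simp only [heven]
  have hp0 : ∏ k ∈ s, μ (ωstar M b k) ≠ 0 := by
    refine Finset.prod_ne_zero_iff.2 fun k _ => (hH2 _ fun i => ?_).ne'
    simp only [ωstar]
    split_ifs <;> simp
  have hlim := ProbabilityTheory.measure_limsup_eq_one hmeas hindep (by
    simp only [hp]
    exact ENNReal.tsum_const_eq_top_of_ne_zero hp0)
  filter_upwards [(mem_ae_iff_prob_eq_one
    (MeasurableSet.measurableSet_limsup hmeas)).2 hlim] with ω hω
  obtain ⟨j, hj⟩ := (Filter.mem_limsup_iff_frequently_mem.1 hω).exists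
  exact ⟨t j, fun k hk => (hj _ (Finset.mem_image_of_mem _ hk)).trans (heven j k)⟩

end Pattern

/-- **Characterization of the edges of the almost sure spectrum.**  Assume (H1), (H2)
(every corner of `Δ` has positive `μ`-probability), and the hypotheses of the spectral
minimization/maximization results.  Then `ℙ`-almost surely,
`inf σ(h_ω) = min σ(h_{ω*})` and `sup σ(h_ω) = max σ(h_{ω*})`. -/
theorem edges_of_almost_sure_spectrum
    (d : ℕ) (hd : 1 ≤ d) (M b : Zd d)
    (hb : ∀ i, 1 ≤ b i) (hbM : ∀ i, b i ≤ M i)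
    (q : Zd d → ℝ)
    (hsupp : ∀ n, n ∉ dbox (fun _ => 1) b → q n = 0)
    (hH1 : ∀ (x : Zd d) (i : Fin d), q x = q (Function.update x i (b i - x i + 1)))
    (hcase : (2 ≤ d ∧ q ≠ 0 ∧ ((∀ n, 0 ≤ q n) ∨ (∀ n, q n ≤ 0)))
      ∨ (d = 1
        ∧ (∃ a : Zd d, (∀ i, 0 ≤ a i ∧ a i ≤ M i - b i) ∧ E0 M q a ≠ -2)
        ∧ (∃ a : Zd d, (∀ i, 0 ≤ a i ∧ a i ≤ M i - b i)
            ∧ E0 M (fun n => -(q n)) a ≠ -2)))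
    (μ : Zd d → ℝ≥0∞)
    (hμsupp : ∀ a : Zd d, ¬ (∀ i, 0 ≤ a i ∧ a i ≤ M i - b i) → μ a = 0)
    (hμtot : ∑ a ∈ dbox (fun _ => 0) (fun i => M i - b i), μ a = 1)
    (hH2 : ∀ a : Zd d, (∀ i, a i = 0 ∨ a i = M i - b i) → 0 < μ a)
    (P : Measure (Zd d → Zd d)) [IsProbabilityMeasure P]
    (hiid : ∀ (s : Finset (Zd d)) (g : Zd d → Zd d),
      P {ω | ∀ k ∈ s, ω k = g k} = ∏ k ∈ s, μ (g k))
    (H : (Zd d → Zd d) → (l2 d →L[ℝ] l2 d))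
    (hH : ∀ ω, adm M b ω → ∀ (u : l2 d) (n : Zd d),
      (H ω u) n = (-∑ j ∈ nbhd n, u j) + Vpot M q ω n * u n) :
    ∀ᵐ ω ∂P,
      sInf (spectrum ℝ (H ω)) = sInf (spectrum ℝ (H (ωstar M b)))
      ∧ sSup (spectrum ℝ (H ω)) = sSup (spectrum ℝ (H (ωstar M b))) := by
  have hsupp' : ∀ n, n ∉ dbox (fun _ => 1) b → -q n = 0 := fun n hn => by simp [hsupp n hn]
  have hH1' : ∀ (x : Zd d) (i : Fin d),
      -q x = -q (Function.update x i (b i - x i + 1)) := fun x i => by rw [← hH1]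
  filter_upwards [ae_adm hμsupp hiid, ae_all_iff.2 (ae_exists_pattern hd hH2 hiid)] with ω hω hpat
  have hstar := adm_ωstar (M := M) hbM
  refine ⟨eq_of_forall_le_iff fun c => ?_, eq_of_forall_ge_iff fun c => ?_⟩
  · rw [le_sInf_spectrum_iff_formNonneg _ _ (hH ω hω),
      le_sInf_spectrum_iff_formNonneg _ _ (hH _ hstar)]
    simp only [sub_sub]
    exact ⟨formNonneg_ωstar_of_pattern hb hbM hsupp hω hpat,
      fun h => formNonneg_of_formNonneg_ωstar hb hbM hsupp hH1 h hω⟩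
  · rw [sSup_spectrum_le_iff_formNonneg _ _ (hH ω hω),
      sSup_spectrum_le_iff_formNonneg _ _ (hH _ hstar)]
    simp only [sub_sub, ← Vpot_neg]
    exact ⟨formNonneg_ωstar_of_pattern hb hbM hsupp' hω hpat,
      fun h => formNonneg_of_formNonneg_ωstar hb hbM hsupp' hH1' h hω⟩
end
end
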